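/- arXiv:1501.00441 — 3 statements merged into one kernel-verified Lean document; each statement's English description precedes it below -/
import Mathlib

section
/- Let Ω ⊂ ℝ² be a bounded open set with smooth boundary, let 0 ≤ b < +∞ and C > 0, and let K ⊂ Ω be compact. Then there exists c = c(b, C, K, Ω) such that for every V : Ω̄ → ℝ with 0 ≤ V ≤ b on Ω and every u ∈ C²(Ω̄) satisfying -Δu = V e^{u} in Ω, u = 0 on ∂Ω, and ∫_Ω e^{u} dx ≤ C, one has sup_K u ≤ c. -/
open MeasureTheory Real Filter Topology Metric Set
open scoped RealInnerProductSpace ENNReal NNReal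

noncomputable section

abbrev E2 : Type := EuclideanSpace ℝ (Fin 2)

/-- The Laplacian `Δ = ∂₁₁ + ∂₂₂` on `ℝ²`. -/
noncomputable def lap (u : E2 → ℝ) (x : E2) : ℝ :=
  ∑ i : Fin 2,
    fderiv ℝ (fun y => fderiv ℝ u y (EuclideanSpace.single i 1)) x (EuclideanSpace.single i 1)

/-- A planar set has smooth boundary: near each boundary point the set is the sublevel set
of a smooth local defining function with nonvanishing derivative. -/
def SmoothBoundary (Ω : Set E2) : Prop :=
  ∀ x ∈ frontier Ω, ∃ (U : Set E2) (f : E2 → ℝ),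
    IsOpen U ∧ x ∈ U ∧ ContDiff ℝ (⊤ : ℕ∞) f ∧ (∀ y ∈ U, fderiv ℝ f y ≠ 0) ∧
    Ω ∩ U = {y ∈ U | f y < 0} ∧ frontier Ω ∩ U = {y ∈ U | f y = 0}

namespace BM

/-! ### The regularized truncated logarithmic kernel -/

/-- cutoff factor -/
def psi (R t : ℝ) : ℝ := (max 0 (1 - t / R ^ 2)) ^ 2

/-- derivative of the cutoff factor -/
def dpsi (R t : ℝ) : ℝ := -(2 * max 0 (1 - t / R ^ 2) / R ^ 2)

/-- radial profile, as a function of the squared radius -/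
def hfun (R ε t : ℝ) : ℝ := ∫ s in t..R ^ 2, psi R s / (2 * (max s 0 + ε ^ 2))

/-- kernel -/
def W (R ε : ℝ) (y : E2) : ℝ := hfun R ε (‖y‖ ^ 2)

/-- coefficient of the gradient of the kernel -/
def kfun (R ε t : ℝ) : ℝ := -(psi R t / (t + ε ^ 2))

def dkfun (R ε t : ℝ) : ℝ := -(dpsi R t / (t + ε ^ 2)) + psi R t / (t + ε ^ 2) ^ 2

/-- concentrating density -/
def rho (R ε : ℝ) (y : E2) : ℝ := 2 * psi R (‖y‖ ^ 2) * ε ^ 2 / (‖y‖ ^ 2 + ε ^ 2) ^ 2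

/-- bounded correction -/
def bump (R ε : ℝ) (y : E2) : ℝ := -(2 * dpsi R (‖y‖ ^ 2) * ‖y‖ ^ 2 / (‖y‖ ^ 2 + ε ^ 2))

lemma psi_nonneg (R t : ℝ) : 0 ≤ psi R t := sq_nonneg _

lemma psi_le_one (R t : ℝ) (ht : 0 ≤ t) : psi R t ≤ 1 := by
  unfold psi
  have h1 : max 0 (1 - t / R ^ 2) ≤ 1 := by
    apply max_le (by norm_num)
    have : 0 ≤ t / R ^ 2 := by positivity
    linarith
  have h0 : 0 ≤ max 0 (1 - t / R ^ 2) := le_max_left _ _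
  nlinarith

lemma psi_ge (R t : ℝ) : 1 - 2 * (t / R ^ 2) ≤ psi R t := by
  unfold psi
  rcases le_total 0 (1 - t / R ^ 2) with h | h
  · rw [max_eq_right h]; nlinarith [sq_nonneg (t / R ^ 2)]
  · rw [max_eq_left h]; nlinarith

lemma max_zero_of_le {R t : ℝ} (hR : 0 < R) (ht : R ^ 2 ≤ t) : max 0 (1 - t / R ^ 2) = 0 := by
  apply max_eq_left
  have : 1 ≤ t / R ^ 2 := by rw [le_div_iff₀ (by positivity)]; linarith
  linarith

lemma psi_zero {R t : ℝ} (hR : 0 < R) (ht : R ^ 2 ≤ t) : psi R t = 0 := by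
  simp [psi, max_zero_of_le hR ht]

lemma dpsi_zero {R t : ℝ} (hR : 0 < R) (ht : R ^ 2 ≤ t) : dpsi R t = 0 := by
  simp [dpsi, max_zero_of_le hR ht]

lemma continuous_psi (R : ℝ) : Continuous (psi R) := by unfold psi; fun_prop

lemma continuous_dpsi (R : ℝ) : Continuous (dpsi R) := by unfold dpsi; fun_prop

lemma hasDerivAt_max_sq (s : ℝ) : HasDerivAt (fun s : ℝ => (max 0 s) ^ 2) (2 * max 0 s) s := by
  rcases lt_trichotomy s 0 with h | h | h
  · rw [max_eq_left h.le]
    have : (fun s : ℝ => (max 0 s) ^ 2) =ᶠ[𝓝 s] fun _ => (0 : ℝ) := by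
      filter_upwards [Iio_mem_nhds h] with x hx
      rw [max_eq_left (le_of_lt hx)]; norm_num
    simpa using (hasDerivAt_const s (0 : ℝ)).congr_of_eventuallyEq this
  · subst h
    rw [hasDerivAt_iff_isLittleO]
    simp only [max_self, ne_eq, OfNat.ofNat_ne_zero, not_false_eq_true, zero_pow, sub_zero,
      mul_zero, smul_zero]
    have h2 : (fun x : ℝ => x ^ 2) =o[𝓝 0] fun x : ℝ => x := by
      simpa using Asymptotics.isLittleO_pow_id (𝕜 := ℝ) (n := 2) (by norm_num)
    refine Asymptotics.IsBigO.trans_isLittleO ?_ h2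
    apply Asymptotics.isBigO_of_le
    intro x
    rw [Real.norm_of_nonneg (sq_nonneg _), Real.norm_of_nonneg (sq_nonneg _)]
    rcases le_total 0 x with h | h
    · rw [max_eq_right h]
    · rw [max_eq_left h]; nlinarith [sq_nonneg x]
  · rw [max_eq_right h.le]
    have : (fun s : ℝ => (max 0 s) ^ 2) =ᶠ[𝓝 s] fun s => s ^ 2 := by
      filter_upwards [Ioi_mem_nhds h] with x hx
      rw [max_eq_right (le_of_lt hx)]
    simpa using (hasDerivAt_pow 2 s).congr_of_eventuallyEq this

lemma hasDerivAt_psi (R t : ℝ) : HasDerivAt (psi R) (dpsi R t) t := by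
  have h1 : HasDerivAt (fun t : ℝ => 1 - t / R ^ 2) (-(1 / R ^ 2)) t := by
    simpa using ((hasDerivAt_id t).div_const (R ^ 2)).const_sub 1
  have := (hasDerivAt_max_sq (1 - t / R ^ 2)).comp t h1
  refine this.congr_deriv ?_
  unfold dpsi; ring

lemma continuous_integrand (R : ℝ) {ε : ℝ} (hε : 0 < ε) :
    Continuous (fun s => psi R s / (2 * (max s 0 + ε ^ 2))) := by
  have := continuous_psi R
  refine this.div (by fun_prop) ?_
  intro s
  have : 0 ≤ max s 0 := le_max_right _ _
  positivity

lemma hasDerivAt_hfun (R : ℝ) {ε t : ℝ} (hε : 0 < ε) (ht : 0 ≤ t) :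
    HasDerivAt (hfun R ε) (kfun R ε t / 2) t := by
  have hc := continuous_integrand R hε
  have := intervalIntegral.integral_hasDerivAt_left (hc.intervalIntegrable t (R ^ 2))
    (hc.stronglyMeasurableAtFilter _ _) hc.continuousAt
  refine this.congr_deriv ?_
  unfold kfun
  rw [max_eq_left ht]
  have : t + ε ^ 2 ≠ 0 := by positivity
  field_simp

lemma hasDerivAt_kfun (R : ℝ) {ε t : ℝ} (hε : 0 < ε) (ht : 0 ≤ t) :
    HasDerivAt (kfun R ε) (dkfun R ε t) t := by
  have h0 : t + ε ^ 2 ≠ 0 := by positivity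
  have := ((hasDerivAt_psi R t).div ((hasDerivAt_id t).add_const (ε ^ 2)) h0).neg
  refine this.congr_deriv ?_
  unfold dkfun
  simp only [id]
  field_simp
  ring

lemma hfun_zero {R ε t : ℝ} (hR : 0 < R) (ht : R ^ 2 ≤ t) : hfun R ε t = 0 := by
  unfold hfun
  rw [intervalIntegral.integral_congr (g := fun _ => (0 : ℝ))]
  · simp
  · intro s hs
    rw [uIcc_of_ge ht] at hs
    simp [psi_zero hR hs.1]

lemma W_zero {R ε : ℝ} (hR : 0 < R) {y : E2} (hy : R ≤ ‖y‖) : W R ε y = 0 :=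
  hfun_zero hR (by gcongr)

lemma hfun_nonneg {R ε t : ℝ} (hR : 0 < R) (ht : 0 ≤ t) : 0 ≤ hfun R ε t := by
  rcases le_total t (R ^ 2) with h | h
  · apply intervalIntegral.integral_nonneg h
    intro s hs
    have : 0 ≤ max s 0 := le_max_right _ _
    have := psi_nonneg R s
    positivity
  · rw [hfun_zero hR h]

lemma W_nonneg {R ε : ℝ} (hR : 0 < R) (y : E2) : 0 ≤ W R ε y := hfun_nonneg hR (by positivity)

lemma integral_inv_two {ε t T : ℝ} (hε : 0 ≤ ε) (ht : 0 ≤ t) (hpos : 0 < t + ε ^ 2) (h : t ≤ T) :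
    IntervalIntegrable (fun s => 1 / (2 * (s + ε ^ 2))) volume t T ∧
    ∫ s in t..T, 1 / (2 * (s + ε ^ 2)) = (1 / 2) * Real.log ((T + ε ^ 2) / (t + ε ^ 2)) := by
  have hd : ∀ s ∈ uIcc t T, HasDerivAt (fun s => (1 / 2) * Real.log (s + ε ^ 2))
      (1 / (2 * (s + ε ^ 2))) s := by
    intro s hs
    rw [uIcc_of_le h] at hs
    have h0 : s + ε ^ 2 ≠ 0 := by linarith [hs.1]
    refine ((((hasDerivAt_id s).add_const (ε ^ 2)).log h0).const_mul (1 / 2)).congr_deriv ?_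
    simp only [id]
    field_simp
  have hi : IntervalIntegrable (fun s => 1 / (2 * (s + ε ^ 2))) volume t T := by
    apply ContinuousOn.intervalIntegrable
    apply ContinuousOn.div (by fun_prop) (by fun_prop)
    intro s hs
    rw [uIcc_of_le h] at hs
    have h0 : 0 < s + ε ^ 2 := by linarith [hs.1]
    positivity
  refine ⟨hi, ?_⟩
  rw [intervalIntegral.integral_eq_sub_of_hasDerivAt hd hi, Real.log_div (by nlinarith) hpos.ne']
  ring

lemma W_le {R ε : ℝ} (hR : 0 < R) (hε : 0 < ε) {y : E2} (hy : y ≠ 0) :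
    W R ε y ≤ Real.posLog (R / ‖y‖) := by
  have hy0 : 0 < ‖y‖ := norm_pos_iff.mpr hy
  rcases le_total R ‖y‖ with h | h
  · rw [W_zero hR h]; exact Real.posLog_nonneg
  · have ht : ‖y‖ ^ 2 ≤ R ^ 2 := by gcongr
    have h2 := integral_inv_two (ε := 0) (t := ‖y‖ ^ 2) (T := R ^ 2) le_rfl (by positivity)
      (by positivity) ht
    calc W R ε y ≤ ∫ s in (‖y‖ ^ 2)..R ^ 2, 1 / (2 * (s + 0 ^ 2)) := by
          apply intervalIntegral.integral_mono_on ht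
            ((continuous_integrand R hε).intervalIntegrable _ _) h2.1
          intro s hs
          have hs0 : 0 < s := lt_of_lt_of_le (by positivity) hs.1
          rw [max_eq_left hs0.le]
          apply div_le_div₀ (by norm_num) (psi_le_one R s hs0.le) (by positivity)
          nlinarith [sq_nonneg ε]
      _ = Real.log (R / ‖y‖) := by
          rw [h2.2]
          simp only [ne_eq, OfNat.ofNat_ne_zero, not_false_eq_true, zero_pow, add_zero]
          rw [← div_pow, Real.log_pow]; push_cast; ring
      _ ≤ _ := le_max_right _ _

lemma W_ge {R ε : ℝ} (hR : 0 < R) (hε : 0 < ε) (y : E2) :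
    (1 / 2) * Real.log (R ^ 2 / (‖y‖ ^ 2 + ε ^ 2)) - 1 ≤ W R ε y := by
  rcases le_total R ‖y‖ with h | h
  · rw [W_zero hR h]
    have : Real.log (R ^ 2 / (‖y‖ ^ 2 + ε ^ 2)) ≤ 0 := by
      apply Real.log_nonpos (by positivity)
      rw [div_le_one (by positivity)]
      nlinarith [sq_nonneg ε]
    linarith
  · have ht : ‖y‖ ^ 2 ≤ R ^ 2 := by gcongr
    have h2 := integral_inv_two (ε := ε) (t := ‖y‖ ^ 2) (T := R ^ 2) hε.le (by positivity)
      (by positivity) ht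
    have h3 : ∫ s in (‖y‖ ^ 2)..R ^ 2, (1 / (2 * (s + ε ^ 2)) - 1 / R ^ 2) ≤ W R ε y := by
      apply intervalIntegral.integral_mono_on ht (h2.1.sub (by simp))
        ((continuous_integrand R hε).intervalIntegrable _ _)
      intro s hs
      have hs0 : 0 ≤ s := le_trans (by positivity) hs.1
      rw [max_eq_left hs0]
      have := psi_ge R s
      have h4 : 1 / (2 * (s + ε ^ 2)) - 1 / R ^ 2 ≤ (1 - 2 * (s / R ^ 2)) / (2 * (s + ε ^ 2)) := by
        rw [sub_div]
        have : 2 * (s / R ^ 2) / (2 * (s + ε ^ 2)) ≤ 1 / R ^ 2 := by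
          have he : 2 * (s / R ^ 2) / (2 * (s + ε ^ 2)) = (s / (s + ε ^ 2)) * (1 / R ^ 2) := by
            field_simp
          rw [he]
          have : s / (s + ε ^ 2) ≤ 1 := by
            rw [div_le_one (by positivity)]; nlinarith [sq_nonneg ε]
          have h5 : 0 ≤ 1 / R ^ 2 := by positivity
          nlinarith
        linarith
      refine h4.trans ?_
      gcongr
    rw [intervalIntegral.integral_sub h2.1 (by simp), h2.2] at h3
    simp only [intervalIntegral.integral_const, smul_eq_mul] at h3
    have h4 : (R ^ 2 - ‖y‖ ^ 2) * (1 / R ^ 2) ≤ 1 := by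
      rw [mul_one_div, div_le_one (by positivity)]; nlinarith [sq_nonneg ‖y‖]
    have h5 : Real.log (R ^ 2 / (‖y‖ ^ 2 + ε ^ 2)) ≤
        Real.log ((R ^ 2 + ε ^ 2) / (‖y‖ ^ 2 + ε ^ 2)) := by
      apply Real.log_le_log (by positivity)
      gcongr
      nlinarith [sq_nonneg ε]
    linarith

lemma hasFDerivAt_normsq (y : E2) :
    HasFDerivAt (fun y : E2 => ‖y‖ ^ 2) (2 • innerSL ℝ y) y := by
  simpa using (hasFDerivAt_id y).norm_sq

lemma hasFDerivAt_W (R : ℝ) {ε : ℝ} (hε : 0 < ε) (y : E2) :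
    HasFDerivAt (W R ε) (kfun R ε (‖y‖ ^ 2) • innerSL ℝ y) y := by
  have := (hasDerivAt_hfun R hε (sq_nonneg ‖y‖)).comp_hasFDerivAt y (hasFDerivAt_normsq y)
  refine this.congr_fderiv ?_
  ext v
  simp
  ring

lemma inner_single' (y : E2) (i : Fin 2) : inner ℝ y (EuclideanSpace.single i (1 : ℝ)) = y i := by
  rw [EuclideanSpace.inner_single_right]; simp

lemma fderiv_W (R : ℝ) {ε : ℝ} (hε : 0 < ε) (y : E2) (i : Fin 2) :
    fderiv ℝ (W R ε) y (EuclideanSpace.single i 1) = kfun R ε (‖y‖ ^ 2) * y i := by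
  rw [(hasFDerivAt_W R hε y).fderiv]
  simp [inner_single', -EuclideanSpace.inner_single_right]

lemma hasFDerivAt_dW (R : ℝ) {ε : ℝ} (hε : 0 < ε) (y : E2) (i : Fin 2) :
    HasFDerivAt (fun y : E2 => kfun R ε (‖y‖ ^ 2) * y i)
      (kfun R ε (‖y‖ ^ 2) • EuclideanSpace.proj (𝕜 := ℝ) i +
        y i • (dkfun R ε (‖y‖ ^ 2) • (2 • innerSL ℝ y))) y := by
  have h1 := (hasDerivAt_kfun R hε (sq_nonneg ‖y‖)).comp_hasFDerivAt y (hasFDerivAt_normsq y)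
  have h2 : HasFDerivAt (fun y : E2 => y i) (EuclideanSpace.proj (𝕜 := ℝ) i : E2 →L[ℝ] ℝ) y :=
    (EuclideanSpace.proj (𝕜 := ℝ) i : E2 →L[ℝ] ℝ).hasFDerivAt
  exact h1.mul h2

/-- pure second derivatives of the kernel -/
def d2W (R ε : ℝ) (i : Fin 2) (y : E2) : ℝ :=
  kfun R ε (‖y‖ ^ 2) + 2 * (y i) ^ 2 * dkfun R ε (‖y‖ ^ 2)

lemma fderiv_dW (R : ℝ) {ε : ℝ} (hε : 0 < ε) (y : E2) (i : Fin 2) :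
    fderiv ℝ (fun y : E2 => kfun R ε (‖y‖ ^ 2) * y i) y (EuclideanSpace.single i 1) =
      d2W R ε i y := by
  rw [(hasFDerivAt_dW R hε y i).fderiv]
  simp [d2W, inner_single', -EuclideanSpace.inner_single_right]
  ring

lemma sum_d2W (R : ℝ) {ε : ℝ} (hε : 0 < ε) (y : E2) :
    ∑ i : Fin 2, d2W R ε i y = bump R ε y - rho R ε y := by
  have h : ‖y‖ ^ 2 = (y 0) ^ 2 + (y 1) ^ 2 := by
    rw [EuclideanSpace.norm_sq_eq]; simp
  have h0 : ‖y‖ ^ 2 + ε ^ 2 ≠ 0 := by positivity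
  have h1 : ∑ i : Fin 2, d2W R ε i y =
      2 * kfun R ε (‖y‖ ^ 2) + 2 * ‖y‖ ^ 2 * dkfun R ε (‖y‖ ^ 2) := by
    simp only [d2W, Fin.sum_univ_two]
    generalize kfun R ε (‖y‖ ^ 2) = a
    generalize dkfun R ε (‖y‖ ^ 2) = b
    rw [h]; ring
  rw [h1]
  unfold kfun dkfun bump rho
  field_simp
  ring

lemma continuous_kfun_norm (R : ℝ) {ε : ℝ} (hε : 0 < ε) :
    Continuous (fun y : E2 => kfun R ε (‖y‖ ^ 2)) := by
  unfold kfun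
  have := continuous_psi R
  refine Continuous.neg (Continuous.div (by fun_prop) (by fun_prop) ?_)
  intro y; positivity

lemma continuous_dkfun_norm (R : ℝ) {ε : ℝ} (hε : 0 < ε) :
    Continuous (fun y : E2 => dkfun R ε (‖y‖ ^ 2)) := by
  unfold dkfun
  have h1 := continuous_psi R
  have h2 := continuous_dpsi R
  refine Continuous.add (Continuous.neg (Continuous.div (by fun_prop) (by fun_prop) ?_))
    (Continuous.div (by fun_prop) (by fun_prop) ?_)
  all_goals intro y; positivity

lemma continuous_d2W (R : ℝ) {ε : ℝ} (hε : 0 < ε) (i : Fin 2) : Continuous (d2W R ε i) := by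
  have h1 := continuous_kfun_norm R hε
  have h2 := continuous_dkfun_norm R hε
  unfold d2W
  fun_prop

lemma continuous_W (R : ℝ) {ε : ℝ} (hε : 0 < ε) : Continuous (W R ε) :=
  continuous_iff_continuousAt.mpr fun y => (hasFDerivAt_W R hε y).continuousAt

lemma bump_nonneg (R ε : ℝ) (y : E2) : 0 ≤ bump R ε y := by
  have h0 : 0 ≤ max 0 (1 - ‖y‖ ^ 2 / R ^ 2) := le_max_left _ _
  have : bump R ε y = 2 * (2 * max 0 (1 - ‖y‖ ^ 2 / R ^ 2) / R ^ 2) * ‖y‖ ^ 2 /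
      (‖y‖ ^ 2 + ε ^ 2) := by
    unfold bump dpsi; ring
  rw [this]; positivity

lemma bump_le {R ε : ℝ} (hε : 0 < ε) (y : E2) : bump R ε y ≤ 4 / R ^ 2 := by
  have h0 : 0 ≤ max 0 (1 - ‖y‖ ^ 2 / R ^ 2) := le_max_left _ _
  have h1 : max 0 (1 - ‖y‖ ^ 2 / R ^ 2) ≤ 1 := by
    apply max_le (by norm_num)
    have : 0 ≤ ‖y‖ ^ 2 / R ^ 2 := by positivity
    linarith
  have : bump R ε y = 4 / R ^ 2 * (max 0 (1 - ‖y‖ ^ 2 / R ^ 2) * (‖y‖ ^ 2 /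
      (‖y‖ ^ 2 + ε ^ 2))) := by
    unfold bump dpsi; ring
  rw [this]
  have h2 : ‖y‖ ^ 2 / (‖y‖ ^ 2 + ε ^ 2) ≤ 1 := by
    rw [div_le_one (by positivity)]; nlinarith [sq_nonneg ε]
  have h3 : 0 ≤ ‖y‖ ^ 2 / (‖y‖ ^ 2 + ε ^ 2) := by positivity
  have h4 : max 0 (1 - ‖y‖ ^ 2 / R ^ 2) * (‖y‖ ^ 2 / (‖y‖ ^ 2 + ε ^ 2)) ≤ 1 := by nlinarith
  have h5 : 0 ≤ 4 / R ^ 2 := by positivity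
  nlinarith

lemma rho_nonneg (R ε : ℝ) (y : E2) : 0 ≤ rho R ε y := by
  unfold rho; have := psi_nonneg R (‖y‖ ^ 2); positivity

lemma bump_zero {R ε : ℝ} (hR : 0 < R) {y : E2} (hy : R ≤ ‖y‖) : bump R ε y = 0 := by
  unfold bump
  rw [dpsi_zero hR (by gcongr)]; simp

lemma rho_zero {R ε : ℝ} (hR : 0 < R) {y : E2} (hy : R ≤ ‖y‖) : rho R ε y = 0 := by
  unfold rho
  rw [psi_zero hR (by gcongr)]; simp

lemma continuous_rho (R : ℝ) {ε : ℝ} (hε : 0 < ε) : Continuous (rho R ε) := by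
  unfold rho
  have h1 := continuous_psi R
  refine Continuous.div (by fun_prop) (by fun_prop) ?_
  intro y; positivity

lemma continuous_bump (R : ℝ) {ε : ℝ} (hε : 0 < ε) : Continuous (bump R ε) := by
  unfold bump
  have h1 := continuous_dpsi R
  refine (Continuous.div (by fun_prop) (by fun_prop) ?_).neg
  intro y; positivity

/-! ### Integration by parts -/

lemma ibp_one (R : ℝ) {ε : ℝ} (hε : 0 < ε) (x : E2) (v : E2 → ℝ)
    (hv : ContDiff ℝ 2 v) (hvc : HasCompactSupport v) (i : Fin 2) :
    Integrable (fun y => W R ε (y - x) *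
      fderiv ℝ (fun y => fderiv ℝ v y (EuclideanSpace.single i 1)) y (EuclideanSpace.single i 1)) ∧
    Integrable (fun y => d2W R ε i (y - x) * v y) ∧
    ∫ y, W R ε (y - x) *
      fderiv ℝ (fun y => fderiv ℝ v y (EuclideanSpace.single i 1)) y (EuclideanSpace.single i 1)
      = ∫ y, d2W R ε i (y - x) * v y := by
  set e : E2 := EuclideanSpace.single i 1 with he
  have hvi : ContDiff ℝ 1 (fun y => fderiv ℝ v y e) :=
    (hv.fderiv_right (m := 1) (by norm_num)).clm_apply contDiff_const
  have hvic : HasCompactSupport (fun y => fderiv ℝ v y e) := hvc.fderiv_apply (𝕜 := ℝ) e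
  have hvii : Continuous (fun y => fderiv ℝ (fun y => fderiv ℝ v y e) y e) :=
    (hvi.continuous_fderiv (by norm_num)).clm_apply continuous_const
  have hviic : HasCompactSupport (fun y => fderiv ℝ (fun y => fderiv ℝ v y e) y e) :=
    hvic.fderiv_apply (𝕜 := ℝ) e
  have hW : Continuous (fun y => W R ε (y - x)) := (continuous_W R hε).comp (by fun_prop)
  have hdW : ∀ y, DifferentiableAt ℝ (fun y => W R ε (y - x)) y := by
    intro y
    exact DifferentiableAt.comp y (hasFDerivAt_W R hε (y - x)).differentiableAt
      (f := fun y => y - x) (by fun_prop)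
  have hdW' : ∀ y, fderiv ℝ (fun y => W R ε (y - x)) y e
      = kfun R ε (‖y - x‖ ^ 2) * (y - x) i := by
    intro y
    rw [fderiv_comp_sub, fderiv_W R hε]
  have hk : Continuous (fun y : E2 => kfun R ε (‖y - x‖ ^ 2) * (y - x) i) := by
    have := (continuous_kfun_norm R hε).comp (continuous_sub_right x)
    exact this.mul (by fun_prop)
  have hddW : ∀ y : E2, DifferentiableAt ℝ
      (fun y : E2 => kfun R ε (‖y - x‖ ^ 2) * (y - x) i) y := by
    intro y
    exact DifferentiableAt.comp y (hasFDerivAt_dW R hε (y - x) i).differentiableAt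
      (f := fun y => y - x) (by fun_prop)
  have hddW' : ∀ y : E2, fderiv ℝ (fun y : E2 => kfun R ε (‖y - x‖ ^ 2) * (y - x) i) y e
      = d2W R ε i (y - x) := by
    intro y
    have := fderiv_comp_sub (𝕜 := ℝ) (f := fun y : E2 => kfun R ε (‖y‖ ^ 2) * y i) (x := y) x
    rw [this, fderiv_dW R hε]
  have hd2 : Continuous (fun y => d2W R ε i (y - x)) := (continuous_d2W R hε i).comp (by fun_prop)
  have i1 : Integrable (fun y => W R ε (y - x) * fderiv ℝ (fun y => fderiv ℝ v y e) y e) :=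
    (hW.mul hvii).integrable_of_hasCompactSupport hviic.mul_left
  have i2 : Integrable (fun y => (kfun R ε (‖y - x‖ ^ 2) * (y - x) i) * fderiv ℝ v y e) :=
    (hk.mul hvi.continuous).integrable_of_hasCompactSupport hvic.mul_left
  have i3 : Integrable (fun y => W R ε (y - x) * fderiv ℝ v y e) :=
    (hW.mul hvi.continuous).integrable_of_hasCompactSupport hvic.mul_left
  have i4 : Integrable (fun y => d2W R ε i (y - x) * v y) :=
    (hd2.mul hv.continuous).integrable_of_hasCompactSupport hvc.mul_left
  have i5 : Integrable (fun y => (kfun R ε (‖y - x‖ ^ 2) * (y - x) i) * v y) :=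
    (hk.mul hv.continuous).integrable_of_hasCompactSupport hvc.mul_left
  refine ⟨i1, i4, ?_⟩
  have A := integral_mul_fderiv_eq_neg_fderiv_mul_of_integrable (μ := volume) (v := e)
    (f := fun y => W R ε (y - x)) (g := fun y => fderiv ℝ v y e)
    (by simpa only [hdW'] using i2) i1 i3
    (fun y _ => hdW y) (fun y _ => (hvi.differentiable (by norm_num)) y)
  have B := integral_mul_fderiv_eq_neg_fderiv_mul_of_integrable (μ := volume) (v := e)
    (f := fun y : E2 => kfun R ε (‖y - x‖ ^ 2) * (y - x) i) (g := v)
    (by simpa only [hddW'] using i4) i2 i5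
    (fun y _ => hddW y) (fun y _ => (hv.differentiable (by norm_num)) y)
  simp only [hdW'] at A
  simp only [hddW'] at B
  rw [A, B, neg_neg]

lemma ibp (R : ℝ) {ε : ℝ} (hε : 0 < ε) (x : E2) (v : E2 → ℝ)
    (hv : ContDiff ℝ 2 v) (hvc : HasCompactSupport v) :
    ∫ y, W R ε (y - x) * lap v y = ∫ y, (bump R ε (y - x) - rho R ε (y - x)) * v y := by
  simp only [lap, Finset.mul_sum]
  rw [integral_finsetSum _ (fun i _ => (ibp_one R hε x v hv hvc i).1)]
  simp only [← sum_d2W R hε, Finset.sum_mul]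
  rw [integral_finsetSum _ (fun i _ => (ibp_one R hε x v hv hvc i).2.1)]
  exact Finset.sum_congr rfl fun i _ => (ibp_one R hε x v hv hvc i).2.2

/-! ### The normalizing constant and the concentration limit -/

def kap : ℝ := ∫ z : E2, 2 / (1 + ‖z‖ ^ 2) ^ 2

lemma integrable_kap : Integrable (fun z : E2 => 2 / (1 + ‖z‖ ^ 2) ^ 2) := by
  have h := (integrable_rpow_neg_one_add_norm_sq (E := E2) (μ := volume) (r := 4)
    (by simp; norm_num)).const_mul 2
  refine h.congr (Eventually.of_forall fun z => ?_)
  have : 0 ≤ 1 + ‖z‖ ^ 2 := by positivity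
  simp only
  rw [show (-4 / 2 : ℝ) = -(2 : ℕ) by norm_num, Real.rpow_neg this, Real.rpow_natCast]
  rfl

lemma kap_pos : 0 < kap := by
  unfold kap
  rw [integral_pos_iff_support_of_nonneg (fun z => by positivity) integrable_kap]
  have : Function.support (fun z : E2 => 2 / (1 + ‖z‖ ^ 2) ^ 2) = univ := by
    ext z
    simp only [Function.mem_support, mem_univ, iff_true]
    positivity
  rw [this]
  simp

lemma tendsto_rho (R : ℝ) (x : E2) (v : E2 → ℝ) (hv : Continuous v)
    (hvc : HasCompactSupport v) :
    Tendsto (fun ε => ∫ y, rho R ε (y - x) * v y) (𝓝[>] 0) (𝓝 (kap * v x)) := by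
  obtain ⟨B, hB⟩ := hv.bounded_above_of_compact_support hvc
  have hB0 : 0 ≤ B := (norm_nonneg _).trans (hB 0)
  have key : ∀ ε : ℝ, 0 < ε → ∫ y, rho R ε (y - x) * v y =
      ∫ z : E2, (2 / (1 + ‖z‖ ^ 2) ^ 2 * psi R (ε ^ 2 * ‖z‖ ^ 2)) * v (x + ε • z) := by
    intro ε hε
    have h1 : ∫ y, rho R ε (y - x) * v y = ∫ y, rho R ε y * v (x + y) := by
      rw [← integral_add_left_eq_self (fun y => rho R ε (y - x) * v y) x]
      simp
    have h2 := Measure.integral_comp_smul (volume : Measure E2)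
      (fun y => rho R ε y * v (x + y)) ε
    rw [h1]
    have h3 : ∫ y, rho R ε y * v (x + y) =
        ε ^ 2 * ∫ z : E2, rho R ε (ε • z) * v (x + ε • z) := by
      rw [h2]
      simp only [finrank_euclideanSpace, Fintype.card_fin, smul_eq_mul]
      rw [abs_of_pos (by positivity), ← mul_assoc, mul_inv_cancel₀ (by positivity), one_mul]
    rw [h3, ← integral_const_mul]
    congr 1
    ext z
    rw [← mul_assoc]
    congr 1
    unfold rho
    rw [norm_smul, Real.norm_of_nonneg hε.le, mul_pow]
    field_simp
    ring
  have hlim : Tendsto (fun ε : ℝ => ∫ z : E2,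
      (2 / (1 + ‖z‖ ^ 2) ^ 2 * psi R (ε ^ 2 * ‖z‖ ^ 2)) * v (x + ε • z)) (𝓝[>] 0)
      (𝓝 (∫ z : E2, 2 / (1 + ‖z‖ ^ 2) ^ 2 * v x)) := by
    apply tendsto_integral_filter_of_dominated_convergence
      (fun z : E2 => 2 / (1 + ‖z‖ ^ 2) ^ 2 * B)
    · refine Eventually.of_forall fun ε => ?_
      have h1 := continuous_psi R
      apply Continuous.aestronglyMeasurable
      refine Continuous.mul (Continuous.mul (Continuous.div (by fun_prop) (by fun_prop) ?_)
        (by fun_prop)) (by fun_prop)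
      intro z; positivity
    · refine Eventually.of_forall fun ε => Eventually.of_forall fun z => ?_
      rw [norm_mul]
      have h1 := psi_nonneg R (ε ^ 2 * ‖z‖ ^ 2)
      have h2 := psi_le_one R (ε ^ 2 * ‖z‖ ^ 2) (by positivity)
      have h3 : 0 ≤ 2 / (1 + ‖z‖ ^ 2) ^ 2 := by positivity
      rw [Real.norm_of_nonneg (mul_nonneg h3 h1)]
      apply mul_le_mul _ (hB _) (norm_nonneg _) h3
      nlinarith
    · exact integrable_kap.mul_const B
    · refine Eventually.of_forall fun z => ?_
      have h1 := continuous_psi R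
      have hc : Continuous (fun ε : ℝ => (2 / (1 + ‖z‖ ^ 2) ^ 2 * psi R (ε ^ 2 * ‖z‖ ^ 2)) *
        v (x + ε • z)) := by fun_prop
      have := (hc.tendsto 0).mono_left (nhdsWithin_le_nhds (s := Ioi 0))
      simpa [psi] using this
  rw [integral_mul_const] at hlim
  refine hlim.congr' ?_
  filter_upwards [self_mem_nhdsWithin] with ε hε
  exact (key ε hε).symm

/-! ### Solutions and their representation -/

structure Sol (Ω : Set E2) (b C : ℝ) (u : E2 → ℝ) : Prop where
  open_ : IsOpen Ω
  smooth : ContDiffOn ℝ 2 u Ω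
  nonneg : ∀ y ∈ Ω, 0 ≤ u y
  lap_nonneg : ∀ y ∈ Ω, 0 ≤ -lap u y
  lap_le : ∀ y ∈ Ω, -lap u y ≤ b * Real.exp (u y)
  int : IntegrableOn (fun y => Real.exp (u y)) Ω
  int_le : ∫ y in Ω, Real.exp (u y) ≤ C
  b_nonneg : 0 ≤ b

/-- right-hand side extended by zero -/
def f0 (Ω : Set E2) (u : E2 → ℝ) : E2 → ℝ := Ω.indicator (fun y => -lap u y)

variable {Ω : Set E2} {b C : ℝ} {u : E2 → ℝ}

lemma continuousOn_lap (hΩ : IsOpen Ω) (hu : ContDiffOn ℝ 2 u Ω) : ContinuousOn (lap u) Ω := by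
  unfold lap
  apply continuousOn_finsetSum
  intro i _
  have h1 : ContDiffOn ℝ 1 (fun y => fderiv ℝ u y (EuclideanSpace.single i 1)) Ω :=
    (hu.fderiv_of_isOpen hΩ (by norm_num)).clm_apply contDiffOn_const
  exact (h1.continuousOn_fderiv_of_isOpen hΩ (by norm_num)).clm_apply continuousOn_const

lemma f0_nonneg (h : Sol Ω b C u) (y : E2) : 0 ≤ f0 Ω u y :=
  indicator_nonneg (fun y hy => h.lap_nonneg y hy) y

lemma f0_eq {y : E2} (hy : y ∈ Ω) : f0 Ω u y = -lap u y := indicator_of_mem hy _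

lemma f0_le (h : Sol Ω b C u) {y : E2} (hy : y ∈ Ω) : f0 Ω u y ≤ b * Real.exp (u y) := by
  rw [f0_eq hy]; exact h.lap_le y hy

lemma measurable_f0 (h : Sol Ω b C u) : Measurable (f0 Ω u) := by
  classical
  have : f0 Ω u = Ω.piecewise (fun y => -lap u y) (fun _ => 0) := by
    unfold f0; rw [← piecewise_eq_indicator]; rfl
  rw [this]
  exact (continuousOn_lap h.open_ h.smooth).neg.measurable_piecewise continuousOn_const
    h.open_.measurableSet

lemma integrable_f0 (h : Sol Ω b C u) : Integrable (f0 Ω u) := by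
  have h1 : Integrable (Ω.indicator fun y => b * Real.exp (u y)) :=
    IntegrableOn.integrable_indicator (h.int.const_mul b) h.open_.measurableSet
  refine h1.mono' (measurable_f0 h).aestronglyMeasurable (Eventually.of_forall fun y => ?_)
  rw [Real.norm_of_nonneg (f0_nonneg h y)]
  exact indicator_le_indicator' fun hy => h.lap_le y hy

lemma integral_f0_le (h : Sol Ω b C u) : ∫ y, f0 Ω u y ≤ b * C := by
  have h1 : Integrable (Ω.indicator fun y => b * Real.exp (u y)) :=
    IntegrableOn.integrable_indicator (h.int.const_mul b) h.open_.measurableSet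
  calc ∫ y, f0 Ω u y ≤ ∫ y, Ω.indicator (fun y => b * Real.exp (u y)) y := by
        apply integral_mono (integrable_f0 h) h1
        intro y
        exact indicator_le_indicator' fun hy => h.lap_le y hy
    _ = b * ∫ y in Ω, Real.exp (u y) := by
        rw [integral_indicator h.open_.measurableSet, integral_const_mul]
    _ ≤ b * C := mul_le_mul_of_nonneg_left h.int_le h.b_nonneg

lemma integrable_W_f0 (h : Sol Ω b C u) {R ε : ℝ} (hR : 0 < R) (hε : 0 < ε) (x : E2) :
    Integrable (fun y => W R ε (y - x) * f0 Ω u y) := by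
  have hWc : HasCompactSupport (W R ε) := by
    apply HasCompactSupport.intro (isCompact_closedBall (0 : E2) R)
    intro y hy
    apply W_zero hR
    simp at hy; exact hy.le
  obtain ⟨B, hB⟩ := (continuous_W R hε).bounded_above_of_compact_support hWc
  exact (integrable_f0 h).bdd_mul
    ((continuous_W R hε).comp (continuous_sub_right x)).aestronglyMeasurable
    (Eventually.of_forall fun y => hB (y - x))

lemma rep (h : Sol Ω b C u) {R : ℝ} (hR : 0 < R) {x : E2} (hx : closedBall x (2 * R) ⊆ Ω) :
    ∃ v : E2 → ℝ, Continuous v ∧ HasCompactSupport v ∧ v x = u x ∧ ∀ ε, 0 < ε →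
      ∫ y, W R ε (y - x) * f0 Ω u y ≤ ∫ y, rho R ε (y - x) * v y ∧
      ∫ y, rho R ε (y - x) * v y ≤ (∫ y, W R ε (y - x) * f0 Ω u y) + 4 / R ^ 2 * C := by
  let χ : ContDiffBump x := ⟨R, 2 * R, hR, by linarith⟩
  have hχs : tsupport χ ⊆ Ω := by rw [χ.tsupport_eq]; exact hx
  set v : E2 → ℝ := fun y => χ y * u y with hvdef
  have hv2 : ContDiff ℝ 2 v := by
    rw [contDiff_iff_contDiffAt]
    intro y
    by_cases hy : y ∈ Ω
    · exact χ.contDiffAt.mul (h.smooth.contDiffAt (h.open_.mem_nhds hy))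
    · have : v =ᶠ[𝓝 y] fun _ => 0 := by
        have h1 : y ∉ tsupport χ := fun h' => hy (hχs h')
        filter_upwards [notMem_tsupport_iff_eventuallyEq.mp h1] with z hz
        simp [hvdef, hz]
      exact contDiffAt_const.congr_of_eventuallyEq this
  have hvc : HasCompactSupport v := χ.hasCompactSupport.mul_right
  have hv0 : ∀ y, 0 ≤ v y := by
    intro y
    by_cases hy : y ∈ Ω
    · exact mul_nonneg χ.nonneg (h.nonneg y hy)
    · have : χ y = 0 := image_eq_zero_of_notMem_tsupport fun h' => hy (hχs h')
      simp [hvdef, this]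
  have hvle : ∀ y, v y ≤ Ω.indicator (fun y => Real.exp (u y)) y := by
    intro y
    by_cases hy : y ∈ Ω
    · rw [indicator_of_mem hy]
      have h1 := h.nonneg y hy
      have h2 := χ.le_one (x := y)
      have h3 := Real.add_one_le_exp (u y)
      simp only [hvdef]
      nlinarith
    · have : χ y = 0 := image_eq_zero_of_notMem_tsupport fun h' => hy (hχs h')
      simp [hvdef, this, indicator_of_notMem hy]
  refine ⟨v, hv2.continuous, hvc, ?_, ?_⟩
  · simp only [hvdef]
    rw [χ.one_of_mem_closedBall (by simp [χ, hR.le])]; simp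
  intro ε hε
  have hI := ibp R hε x v hv2 hvc
  have hL : ∫ y, W R ε (y - x) * lap v y = -∫ y, W R ε (y - x) * f0 Ω u y := by
    rw [← integral_neg]
    congr 1
    ext y
    rcases le_or_gt R ‖y - x‖ with hy | hy
    · rw [W_zero hR hy]; simp
    · have hyb : y ∈ ball x R := by rwa [mem_ball, dist_eq_norm]
      have hyΩ : y ∈ Ω := hx (ball_subset_closedBall (ball_subset_ball (by linarith) hyb))
      have he : v =ᶠ[𝓝 y] u := by
        filter_upwards [isOpen_ball.mem_nhds hyb] with z hz
        simp only [hvdef]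
        rw [χ.one_of_mem_closedBall (ball_subset_closedBall hz)]; simp
      have : lap v y = lap u y := by
        unfold lap
        apply Finset.sum_congr rfl
        intro i _
        have h2 : (fun z => fderiv ℝ v z (EuclideanSpace.single i 1)) =ᶠ[𝓝 y]
            (fun z => fderiv ℝ u z (EuclideanSpace.single i 1)) := by
          filter_upwards [he.fderiv (𝕜 := ℝ)] with z hz
          rw [hz]
        rw [h2.fderiv_eq]
      rw [this, f0_eq hyΩ]; ring
  have hbc : Continuous (fun y => bump R ε (y - x) * v y) :=
    ((continuous_bump R hε).comp (continuous_sub_right x)).mul hv2.continuous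
  have hrc : Continuous (fun y => rho R ε (y - x) * v y) :=
    ((continuous_rho R hε).comp (continuous_sub_right x)).mul hv2.continuous
  have hbi : Integrable (fun y => bump R ε (y - x) * v y) :=
    hbc.integrable_of_hasCompactSupport hvc.mul_left
  have hri : Integrable (fun y => rho R ε (y - x) * v y) :=
    hrc.integrable_of_hasCompactSupport hvc.mul_left
  simp only [sub_mul] at hI
  rw [integral_sub hbi hri, hL] at hI
  have hb0 : 0 ≤ ∫ y, bump R ε (y - x) * v y :=
    integral_nonneg fun y => mul_nonneg (bump_nonneg _ _ _) (hv0 y)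
  have hb1 : ∫ y, bump R ε (y - x) * v y ≤ 4 / R ^ 2 * C := by
    have hi : Integrable (Ω.indicator fun y => Real.exp (u y)) :=
      h.int.integrable_indicator h.open_.measurableSet
    calc ∫ y, bump R ε (y - x) * v y
        ≤ ∫ y, 4 / R ^ 2 * Ω.indicator (fun y => Real.exp (u y)) y := by
          apply integral_mono hbi (hi.const_mul _)
          intro y
          exact mul_le_mul (bump_le hε _) (hvle y) (hv0 y) (by positivity)
      _ = 4 / R ^ 2 * ∫ y in Ω, Real.exp (u y) := by
          rw [integral_const_mul, integral_indicator h.open_.measurableSet]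
      _ ≤ _ := mul_le_mul_of_nonneg_left h.int_le (by positivity)
  constructor <;> linarith

lemma lower (h : Sol Ω b C u) {R : ℝ} (hR : 0 < R) {x : E2} (hx : closedBall x (2 * R) ⊆ Ω)
    {S : Set E2} (hS : MeasurableSet S) {s : ℝ} (hs : 0 < s) (hSs : S ⊆ closedBall x s) :
    ((1 / 2) * Real.log (R ^ 2 / (2 * s ^ 2)) - 1) * (∫ y in S, f0 Ω u y) ≤ kap * u x := by
  obtain ⟨v, hv, hvc, hvx, hrep⟩ := rep h hR hx
  have hlim := tendsto_rho R x v hv hvc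
  rw [hvx] at hlim
  apply ge_of_tendsto hlim
  have : ∀ᶠ ε in 𝓝[>] (0 : ℝ), ε ∈ Ioc 0 s := Ioc_mem_nhdsGT hs
  filter_upwards [this] with ε hε
  refine le_trans ?_ (hrep ε hε.1).1
  rw [← integral_indicator hS, ← integral_const_mul]
  apply integral_mono (((integrable_f0 h).indicator hS).const_mul _) (integrable_W_f0 h hR hε.1 x)
  intro y
  by_cases hy : y ∈ S
  · simp only [indicator_of_mem hy]
    apply mul_le_mul_of_nonneg_right _ (f0_nonneg h y)
    refine le_trans ?_ (W_ge hR hε.1 (y - x))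
    have h1 : ‖y - x‖ ≤ s := by simpa [dist_eq_norm] using hSs hy
    have h3 := hε.2
    have h4 := hε.1
    have h2 : Real.log (R ^ 2 / (2 * s ^ 2)) ≤ Real.log (R ^ 2 / (‖y - x‖ ^ 2 + ε ^ 2)) := by
      apply Real.log_le_log (by positivity)
      apply div_le_div_of_nonneg_left (by positivity) (by positivity)
      have : ‖y - x‖ ^ 2 ≤ s ^ 2 := by gcongr
      have : ε ^ 2 ≤ s ^ 2 := by gcongr
      linarith
    linarith
  · simp only [indicator_of_notMem hy, mul_zero]
    exact mul_nonneg (W_nonneg hR _) (f0_nonneg h y)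

/-! ### Singular kernels -/

def Q (R α : ℝ) (z : E2) : ℝ := Real.exp (α * Real.posLog (R / ‖z‖))

lemma measurable_posLog_norm (R : ℝ) : Measurable (fun z : E2 => Real.posLog (R / ‖z‖)) := by
  apply Real.continuous_posLog.measurable.comp
  fun_prop

lemma measurable_Q (R α : ℝ) : Measurable (Q R α) :=
  Real.measurable_exp.comp ((measurable_posLog_norm R).const_mul α)

lemma integrableOn_Q {R r α : ℝ} (hR : 0 < R) (hα0 : 0 ≤ α) (hα : α < 2) (hr : R ≤ r) :
    IntegrableOn (Q R α) (ball 0 r) := by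
  apply integrableOn_ball_of_norm_le_rpow (C := r ^ α) (α := α) (by simp) (by simpa using hα) _
    (measurable_Q R α).aestronglyMeasurable
  rw [ae_restrict_iff' measurableSet_ball]
  have h0 : ∀ᵐ z : E2, z ≠ 0 := by simp [ae_iff]
  filter_upwards [h0] with z hz hzr
  have hz0 : 0 < ‖z‖ := norm_pos_iff.mpr hz
  have hzr' : ‖z‖ < r := by simpa using hzr
  have hr0 : 0 < r := hR.trans_le hr
  have h1 : Real.posLog (R / ‖z‖) ≤ Real.log (r / ‖z‖) := by
    apply max_le
    · apply Real.log_nonneg; rw [le_div_iff₀ hz0]; linarith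
    · apply Real.log_le_log (by positivity); gcongr
  unfold Q
  rw [Real.norm_of_nonneg (Real.exp_pos _).le, Real.rpow_neg hz0.le, ← div_eq_mul_inv,
    ← Real.div_rpow hr0.le hz0.le, Real.rpow_def_of_pos (by positivity), mul_comm]
  gcongr

lemma posLog_le_Q (R : ℝ) (z : E2) : Real.posLog (R / ‖z‖) ≤ Q R 1 z := by
  unfold Q
  rw [one_mul]
  linarith [Real.add_one_le_exp (Real.posLog (R / ‖z‖))]

lemma posLog_zero' {R : ℝ} (hR : 0 < R) {z : E2} (hz : R ≤ ‖z‖) : Real.posLog (R / ‖z‖) = 0 := by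
  rw [Real.posLog_eq_zero_iff, abs_of_nonneg (by positivity)]
  exact div_le_one_of_le₀ hz (norm_nonneg _)

lemma Q_nonneg (R α : ℝ) (z : E2) : 0 ≤ Q R α z := (Real.exp_pos _).le

lemma f0_bdd (h : Sol Ω b C u) {K : Set E2} (hK : IsCompact K) (hKΩ : K ⊆ Ω) :
    ∃ B, 0 ≤ B ∧ ∀ y ∈ K, f0 Ω u y ≤ B := by
  obtain ⟨B, hB⟩ := hK.exists_bound_of_continuousOn
    ((continuousOn_lap h.open_ h.smooth).mono hKΩ)
  refine ⟨max B 0, le_max_right _ _, fun y hy => ?_⟩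
  rw [f0_eq (hKΩ hy)]
  refine le_trans ?_ (le_max_left _ _)
  exact (neg_le_abs _).trans (hB y hy)

lemma integrable_translate_Q {R r α : ℝ} (hR : 0 < R) (hα0 : 0 ≤ α) (hα : α < 2) (hr : R ≤ r)
    (x : E2) : IntegrableOn (fun y => Q R α (y - x)) (ball x r) := by
  have h1 := (integrableOn_Q hR hα0 hα hr).integrable_indicator measurableSet_ball
  have h2 := h1.comp_sub_right x
  rw [← integrable_indicator_iff measurableSet_ball]
  refine h2.congr (Eventually.of_forall fun y => ?_)
  simp [indicator, dist_eq_norm]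

lemma upper (h : Sol Ω b C u) {R : ℝ} (hR : 0 < R) {x : E2} (hx : closedBall x (2 * R) ⊆ Ω) :
    Integrable (fun y => Real.posLog (R / ‖y - x‖) * f0 Ω u y) ∧
    kap * u x ≤ (∫ y, Real.posLog (R / ‖y - x‖) * f0 Ω u y) + 4 / R ^ 2 * C := by
  obtain ⟨B, hB0, hB⟩ := f0_bdd h (isCompact_closedBall x R)
    ((closedBall_subset_closedBall (by linarith)).trans hx)
  have hI : Integrable (fun y => Real.posLog (R / ‖y - x‖) * f0 Ω u y) := by
    have h1 := IntegrableOn.integrable_indicator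
      ((integrable_translate_Q hR zero_le_one one_lt_two le_rfl x).mul_const B) measurableSet_ball
    refine h1.mono' (((measurable_posLog_norm R).comp (measurable_id.sub_const x)).mul
      (measurable_f0 h)).aestronglyMeasurable (Eventually.of_forall fun y => ?_)
    rw [Real.norm_of_nonneg (mul_nonneg Real.posLog_nonneg (f0_nonneg h y))]
    by_cases hy : y ∈ ball x R
    · rw [indicator_of_mem hy]
      exact mul_le_mul (posLog_le_Q R _) (hB y (ball_subset_closedBall hy)) (f0_nonneg h y)
        (Q_nonneg _ _ _)
    · rw [indicator_of_notMem hy, posLog_zero' hR, zero_mul]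
      simpa [dist_eq_norm] using hy
  refine ⟨hI, ?_⟩
  obtain ⟨v, hv, hvc, hvx, hrep⟩ := rep h hR hx
  have hlim := tendsto_rho R x v hv hvc
  rw [hvx] at hlim
  apply le_of_tendsto hlim
  filter_upwards [self_mem_nhdsWithin] with ε hε
  refine (hrep ε hε).2.trans ?_
  gcongr ?_ + _
  apply integral_mono_ae (integrable_W_f0 h hR hε x) hI
  have h0 : ∀ᵐ y : E2, y ≠ x := by simp [ae_iff]
  filter_upwards [h0] with y hy
  exact mul_le_mul_of_nonneg_right (W_le hR hε (sub_ne_zero.mpr hy)) (f0_nonneg h y)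

/-! ### Uniform bound for the mass of small balls -/

lemma mass_bound {R C : ℝ} (hR : 0 < R) (hC : 0 < C) :
    ∃ r δ : ℝ, 0 < r ∧ 3 * r < R ∧ 0 < δ ∧ δ < 1 ∧ ∀ (Ω : Set E2) (b : ℝ) (u : E2 → ℝ),
      Sol Ω b C u → ∀ x₀, closedBall x₀ (3 * R) ⊆ Ω →
      ∫ y in ball x₀ r, f0 Ω u y ≤ (2 - δ) * kap := by
  set a : ℝ := R / (3 * Real.exp 1) with ha
  have ha0 : 0 < a := by positivity
  have he : 1 ≤ Real.exp 1 := Real.one_le_exp (by norm_num)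
  have ha1 : 3 * a ≤ R := by
    have h3 : 3 * a = R / Real.exp 1 := by rw [ha]; field_simp
    rw [h3]
    exact div_le_self hR.le he
  set ω : ℝ := (volume : Measure E2).real (ball 0 1) with hω
  have hω0 : 0 < ω := by
    rw [hω]
    exact ENNReal.toReal_pos (measure_ball_pos _ _ one_pos).ne' measure_ball_lt_top.ne
  set L : ℝ := (C + 1) / (a ^ 2 * ω) with hL
  have hL0 : 0 < L := by positivity
  set r : ℝ := a * Real.exp (-L) with hr
  have hr0 : 0 < r := by positivity
  have hra : r < a := by
    rw [hr]
    have : Real.exp (-L) < 1 := by simpa using hL0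
    nlinarith
  set δ : ℝ := 1 / (2 * L + 2) with hδ
  have hδ0 : 0 < δ := by positivity
  have hδ1 : δ < 1 := by rw [hδ, div_lt_one (by positivity)]; linarith
  have hLδ : L * δ ≤ 1 / 2 := by
    rw [hδ, mul_one_div, div_le_iff₀ (by positivity)]; linarith
  refine ⟨r, δ, hr0, by linarith, hδ0, hδ1, ?_⟩
  intro Ω b u h x₀ hx₀
  by_contra! hm
  set m := ∫ y in ball x₀ r, f0 Ω u y with hmdef
  -- the radial function
  let g : ℝ → ℝ := (Ico r a).indicator (fun y => (a / y) ^ 2 / 2)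
  have hint : ∫ z : E2, g ‖z‖ = C + 1 := by
    rw [integral_fun_norm_addHaar (volume : Measure E2) g]
    simp only [finrank_euclideanSpace, Fintype.card_fin, smul_eq_mul, nsmul_eq_mul]
    have h1 : ∫ y in Ioi (0 : ℝ), y ^ (2 - 1) * g y = ∫ y in r..a, (a ^ 2 / 2) * y⁻¹ := by
      rw [intervalIntegral.integral_of_le hra.le, ← integral_Ico_eq_integral_Ioc,
        ← integral_indicator measurableSet_Ioi, ← integral_indicator measurableSet_Ico]
      congr 1
      ext y
      by_cases hy : y ∈ Ico r a
      · have hy0 : 0 < y := hr0.trans_le hy.1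
        rw [indicator_of_mem (show y ∈ Ioi 0 from hy0), indicator_of_mem hy]
        simp only [g, indicator_of_mem hy]
        field_simp
        ring
      · rw [indicator_of_notMem hy]
        simp only [g, indicator]
        simp [hy]
    rw [h1, intervalIntegral.integral_const_mul, integral_inv_of_pos hr0 ha0]
    have h2 : Real.log (a / r) = L := by
      rw [hr, div_mul_cancel_left₀ ha0.ne', ← Real.exp_neg, Real.log_exp]; ring
    rw [h2, ← hω, hL]
    push_cast
    field_simp
  have hint' : ∫ z : E2, g ‖z - x₀‖ = C + 1 := by
    rw [← hint]; exact integral_sub_right_eq_self (fun z : E2 => g ‖z‖) x₀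
  have hgi : Integrable (fun z : E2 => g ‖z - x₀‖) :=
    Integrable.of_integral_ne_zero (by rw [hint']; positivity)
  have hle : ∀ z : E2, g ‖z - x₀‖ ≤ Ω.indicator (fun y => Real.exp (u y)) z := by
    intro z
    by_cases hz : ‖z - x₀‖ ∈ Ico r a
    swap
    · simp only [g, indicator_of_notMem hz]
      exact indicator_nonneg (fun y _ => (Real.exp_pos _).le) z
    set s := ‖z - x₀‖ with hs
    have hs0 : 0 < s := hr0.trans_le hz.1
    have hdist : dist z x₀ = s := by rw [dist_eq_norm]
    have hzB : closedBall z (2 * R) ⊆ Ω := by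
      refine (closedBall_subset_closedBall' ?_).trans hx₀
      rw [hdist]; linarith [hz.2]
    have hzΩ : z ∈ Ω := hzB (mem_closedBall_self (by positivity))
    rw [indicator_of_mem hzΩ]
    simp only [g, indicator_of_mem hz]
    have hlow := lower h hR hzB (S := ball x₀ r) measurableSet_ball (s := 2 * s) (by positivity)
      (by
        refine ball_subset_closedBall.trans (closedBall_subset_closedBall' ?_)
        rw [dist_comm, hdist]; linarith [hz.1])
    rw [← hmdef] at hlow
    have hlog0 : 0 ≤ Real.log (a / s) := Real.log_nonneg (by
      rw [le_div_iff₀ hs0]; linarith [hz.2])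
    have hlog : Real.log (a / s) ≤ 1 / 2 * Real.log (R ^ 2 / (2 * (2 * s) ^ 2)) - 1 := by
      have e1 : Real.log (a / s) = 1 / 2 * Real.log ((R / (3 * s)) ^ 2) - 1 := by
        rw [Real.log_pow, show a / s = (R / (3 * s)) / Real.exp 1 by rw [ha]; field_simp,
          Real.log_div (by positivity) (by positivity), Real.log_exp]
        push_cast; ring
      rw [e1]
      have : Real.log ((R / (3 * s)) ^ 2) ≤ Real.log (R ^ 2 / (2 * (2 * s) ^ 2)) := by
        apply Real.log_le_log (by positivity)
        rw [div_pow]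
        apply div_le_div_of_nonneg_left (by positivity) (by positivity)
        nlinarith [sq_nonneg s]
      linarith
    have hk := kap_pos
    have hm0 : 0 ≤ m := le_trans (by apply mul_nonneg <;> linarith) hm.le
    have h1 : Real.log (a / s) * ((2 - δ) * kap) ≤ kap * u z := by
      refine le_trans ?_ hlow
      apply mul_le_mul hlog hm.le (by apply mul_nonneg <;> linarith) (hlog0.trans hlog)
    have h2 : (2 - δ) * Real.log (a / s) ≤ u z := by
      have : kap * ((2 - δ) * Real.log (a / s)) ≤ kap * u z := by linarith
      exact le_of_mul_le_mul_left this hk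
    have h3 : Real.log (a / s) ≤ L := by
      have : a / s ≤ a / r := by gcongr; exact hz.1
      have h4 : Real.log (a / r) = L := by
        rw [hr, div_mul_cancel_left₀ ha0.ne', ← Real.exp_neg, Real.log_exp]; ring
      rw [← h4]
      exact Real.log_le_log (by positivity) this
    have h5 : 2 * Real.log (a / s) - 1 / 2 ≤ u z := by nlinarith
    calc (a / s) ^ 2 / 2 = Real.exp (2 * Real.log (a / s)) / 2 := by
          rw [show (2 : ℝ) * Real.log (a / s) = ((2 : ℕ) : ℝ) * Real.log (a / s) by norm_num,
            ← Real.log_pow, Real.exp_log (by positivity)]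
      _ ≤ Real.exp (2 * Real.log (a / s)) * Real.exp (-(1 / 2)) := by
          have : (1 : ℝ) / 2 ≤ Real.exp (-(1 / 2)) := by
            linarith [Real.add_one_le_exp (-(1 / 2) : ℝ)]
          have h6 := Real.exp_pos (2 * Real.log (a / s))
          nlinarith
      _ = Real.exp (2 * Real.log (a / s) - 1 / 2) := by rw [← Real.exp_add]; rfl
      _ ≤ _ := Real.exp_le_exp.mpr h5
  have hfin : C + 1 ≤ C := by
    rw [← hint']
    refine le_trans ?_ h.int_le
    rw [← integral_indicator h.open_.measurableSet]
    exact integral_mono hgi (h.int.integrable_indicator h.open_.measurableSet) hle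
  linarith

/-! ### Exponential integrability and the pointwise bound -/

lemma jensen {w g : E2 → ℝ} {t : ℝ} (hw0 : ∀ y, 0 ≤ w y) (hw : Integrable w)
    (hw1 : ∫ y, w y ≤ 1) (hg : Integrable (fun y => g y * w y))
    (he : Integrable (fun y => Real.exp (t * g y) * w y)) :
    Real.exp (t * ∫ y, g y * w y) ≤ 1 + ∫ y, Real.exp (t * g y) * w y := by
  set A := t * ∫ y, g y * w y with hA
  set θ := ∫ y, w y with hθ
  have hθ0 : 0 ≤ θ := integral_nonneg hw0
  have h1 : ∫ y, (Real.exp A * (1 - A) * w y + Real.exp A * t * (g y * w y)) ≤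
      ∫ y, Real.exp (t * g y) * w y := by
    apply integral_mono ((hw.const_mul _).add (hg.const_mul _)) he
    intro y
    have h2 : Real.exp A * (1 + (t * g y - A)) ≤ Real.exp (t * g y) := by
      have : Real.exp (t * g y) = Real.exp A * Real.exp (t * g y - A) := by
        rw [← Real.exp_add]; congr 1; ring
      rw [this]
      have := Real.add_one_le_exp (t * g y - A)
      have := Real.exp_pos A
      gcongr
      linarith
    have := mul_le_mul_of_nonneg_right h2 (hw0 y)
    simp only [Pi.add_apply]
    nlinarith
  rw [integral_add (hw.const_mul _) (hg.const_mul _), integral_const_mul, integral_const_mul,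
    ← hθ] at h1
  have h3 : Real.exp A * t * (∫ y, g y * w y) = Real.exp A * A := by rw [hA]; ring
  rw [h3] at h1
  have h4 : Real.exp A * (1 - A) ≤ 1 := by
    have h5 : 1 - A ≤ Real.exp (-A) := by linarith [Real.add_one_le_exp (-A)]
    have h6 : Real.exp A * Real.exp (-A) = 1 := by rw [← Real.exp_add]; simp
    have := mul_le_mul_of_nonneg_left h5 (Real.exp_pos A).le
    linarith
  nlinarith [mul_le_mul_of_nonneg_right h4 (sub_nonneg.mpr hw1)]

lemma integrable_Q_f0 (h : Sol Ω b C u) {R r α : ℝ} (hR : 0 < R) (hα0 : 0 ≤ α) (hα : α < 2)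
    {x x₀ : E2} (hΩ : closedBall x₀ (3 * R) ⊆ Ω) (hr : r ≤ R) (hx : ball x₀ r ⊆ ball x R) :
    Integrable (fun y => Q R α (y - x) * (ball x₀ r).indicator (f0 Ω u) y) := by
  obtain ⟨B, hB0, hB⟩ := f0_bdd h (isCompact_closedBall x₀ (3 * R)) hΩ
  have h1 := IntegrableOn.integrable_indicator
      ((integrable_translate_Q hR hα0 hα le_rfl x).mul_const B) measurableSet_ball
  refine h1.mono' (((measurable_Q R α).comp (measurable_id.sub_const x)).mul
    ((measurable_f0 h).indicator measurableSet_ball)).aestronglyMeasurable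
    (Eventually.of_forall fun y => ?_)
  rw [Real.norm_of_nonneg (mul_nonneg (Q_nonneg _ _ _)
    (indicator_nonneg (fun y _ => f0_nonneg h y) y))]
  by_cases hy : y ∈ ball x₀ r
  · rw [indicator_of_mem hy, indicator_of_mem (hx hy)]
    exact mul_le_mul_of_nonneg_left
      (hB y (ball_subset_closedBall (ball_subset_ball (by linarith) hy))) (Q_nonneg _ _ _)
  · rw [indicator_of_notMem hy, mul_zero]
    exact indicator_nonneg (fun y _ => mul_nonneg (Q_nonneg _ _ _) hB0) y

lemma integrable_log_f0 (h : Sol Ω b C u) {R r : ℝ} (hR : 0 < R)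
    {x x₀ : E2} (hΩ : closedBall x₀ (3 * R) ⊆ Ω) (hr : r ≤ R) (hx : ball x₀ r ⊆ ball x R) :
    Integrable (fun y => Real.posLog (R / ‖y - x‖) * (ball x₀ r).indicator (f0 Ω u) y) := by
  refine (integrable_Q_f0 h hR zero_le_one one_lt_two hΩ hr hx).mono'
    (((measurable_posLog_norm R).comp (measurable_id.sub_const x)).mul
    ((measurable_f0 h).indicator measurableSet_ball)).aestronglyMeasurable
    (Eventually.of_forall fun y => ?_)
  have h0 : 0 ≤ (ball x₀ r).indicator (f0 Ω u) y := indicator_nonneg (fun y _ => f0_nonneg h y) y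
  rw [Real.norm_of_nonneg (mul_nonneg Real.posLog_nonneg h0)]
  exact mul_le_mul_of_nonneg_right (posLog_le_Q R _) h0

/-- splitting of the upper bound -/
lemma split (h : Sol Ω b C u) {R r σ : ℝ} (hR : 0 < R) (hσ : 0 < σ)
    {x x₀ : E2} (hΩ : closedBall x₀ (3 * R) ⊆ Ω) (hr : r ≤ R) (hx : ball x₀ r ⊆ ball x R)
    (hxx : dist x x₀ ≤ R) (hσx : ball x σ ⊆ ball x₀ r) :
    kap * u x ≤ (∫ y, Real.posLog (R / ‖y - x‖) * (ball x₀ r).indicator (f0 Ω u) y) +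
      (Real.posLog (R / σ) * (b * C) + 4 / R ^ 2 * C) := by
  have hup := upper h hR (x := x)
    ((closedBall_subset_closedBall' (by linarith)).trans hΩ)
  have h1 : ∫ y, Real.posLog (R / ‖y - x‖) * f0 Ω u y ≤
      ∫ y, (Real.posLog (R / ‖y - x‖) * (ball x₀ r).indicator (f0 Ω u) y +
        Real.posLog (R / σ) * f0 Ω u y) := by
    apply integral_mono hup.1
      ((integrable_log_f0 h hR hΩ hr hx).add ((integrable_f0 h).const_mul _))
    intro y
    have hf := f0_nonneg h y
    by_cases hy : y ∈ ball x₀ r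
    · simp only [Pi.add_apply, indicator_of_mem hy]
      have : 0 ≤ Real.posLog (R / σ) * f0 Ω u y := mul_nonneg Real.posLog_nonneg hf
      linarith
    · simp only [Pi.add_apply, indicator_of_notMem hy, mul_zero, zero_add]
      apply mul_le_mul_of_nonneg_right _ hf
      have h2 : y ∉ ball x σ := fun h' => hy (hσx h')
      have h3 : σ ≤ ‖y - x‖ := by simpa [dist_eq_norm] using h2
      apply Real.posLog_le_posLog (by positivity)
      gcongr
  rw [integral_add (integrable_log_f0 h hR hΩ hr hx) ((integrable_f0 h).const_mul _),
    integral_const_mul] at h1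
  have h2 := mul_le_mul_of_nonneg_left (integral_f0_le h)
    (Real.posLog_nonneg (x := R / σ))
  linarith [hup.2]

lemma exp_bound {R r δ b C : ℝ} (hR : 0 < R) (hr0 : 0 < r) (hrR : 3 * r < R)
    (hδ : 0 < δ) (hδ1 : δ < 1) :
    ∃ p N : ℝ, 1 < p ∧ ∀ (Ω : Set E2) (u : E2 → ℝ),
      Sol Ω b C u → ∀ x₀, closedBall x₀ (3 * R) ⊆ Ω →
      ∫ y in ball x₀ r, f0 Ω u y ≤ (2 - δ) * kap →
      IntegrableOn (fun x => Real.exp (p * u x)) (ball x₀ (r / 2)) ∧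
      ∫ x in ball x₀ (r / 2), Real.exp (p * u x) ≤ N := by
  have hk := kap_pos
  set α : ℝ := 2 - δ / 2 with hα
  set p : ℝ := α / (2 - δ) with hp
  have hp1 : 1 < p := by rw [hp, one_lt_div (by linarith)]; rw [hα]; linarith
  set D : ℝ := Real.posLog (R / (r / 2)) * (b * C) + 4 / R ^ 2 * C with hD
  set E : ℝ := Real.exp (p / kap * D) with hE
  set J : ℝ≥0∞ := ∫⁻ z in ball (0 : E2) R, ENNReal.ofReal (Q R α z) with hJ
  have hJfin : J < ⊤ :=
    (integrableOn_Q hR (by rw [hα]; linarith) (by rw [hα]; linarith) le_rfl).lintegral_lt_top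
  set NN : ℝ≥0∞ := ENNReal.ofReal E * (volume (ball (0 : E2) (r / 2)) + J) with hNN
  have hNNfin : NN ≠ ⊤ :=
    ENNReal.mul_ne_top ENNReal.ofReal_ne_top
      (ENNReal.add_ne_top.mpr ⟨measure_ball_lt_top.ne, hJfin.ne⟩)
  refine ⟨p, NN.toReal, hp1, ?_⟩
  intro Ω u h x₀ hΩ hm
  have hcont : ContinuousOn (fun x => Real.exp (p * u x)) (closedBall x₀ (r / 2)) := by
    have : ContinuousOn u (closedBall x₀ (r / 2)) :=
      h.smooth.continuousOn.mono ((closedBall_subset_closedBall (by linarith)).trans hΩ)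
    exact Real.continuous_exp.comp_continuousOn (continuousOn_const.mul this)
  have hint : IntegrableOn (fun x => Real.exp (p * u x)) (ball x₀ (r / 2)) :=
    (hcont.integrableOn_compact (isCompact_closedBall _ _)).mono_set ball_subset_closedBall
  refine ⟨hint, ?_⟩
  set M : ℝ := (2 - δ) * kap with hM
  have hM0 : 0 < M := mul_pos (by linarith) hk
  let w : E2 → ℝ := fun y => (ball x₀ r).indicator (f0 Ω u) y / M
  have hi0 : ∀ y, 0 ≤ (ball x₀ r).indicator (f0 Ω u) y :=
    fun y => indicator_nonneg (fun y _ => f0_nonneg h y) y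
  have hw0 : ∀ y, 0 ≤ w y := fun y => div_nonneg (hi0 y) hM0.le
  have hwm : Measurable w := ((measurable_f0 h).indicator measurableSet_ball).div_const M
  have hwi : Integrable w := ((integrable_f0 h).indicator measurableSet_ball).div_const M
  have hw1 : ∫ y, w y ≤ 1 := by
    simp only [w]
    rw [integral_div, integral_indicator measurableSet_ball, div_le_one hM0]
    exact hm
  have hpt : ∀ x ∈ ball x₀ (r / 2), ENNReal.ofReal (Real.exp (p * u x)) ≤
      ENNReal.ofReal E * (1 + ∫⁻ y, ENNReal.ofReal (Q R α (y - x)) * ENNReal.ofReal (w y)) := by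
    intro x hx
    have hdx : dist x x₀ < r / 2 := hx
    have hbx : ball x₀ r ⊆ ball x R := by
      apply ball_subset_ball'
      rw [dist_comm]; linarith
    have hsp := split h hR (σ := r / 2) (by positivity) hΩ (r := r) (by linarith) hbx (by linarith)
      (ball_subset_ball' (by linarith))
    have hgw : ∀ y, Real.posLog (R / ‖y - x‖) * w y =
        Real.posLog (R / ‖y - x‖) * (ball x₀ r).indicator (f0 Ω u) y / M := fun y => by
      simp only [w]; ring
    have hQw : ∀ y, Real.exp (α * Real.posLog (R / ‖y - x‖)) * w y =
        Q R α (y - x) * (ball x₀ r).indicator (f0 Ω u) y / M := fun y => by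
      simp only [w, Q]; ring
    have hQi : Integrable (fun y => Real.exp (α * Real.posLog (R / ‖y - x‖)) * w y) := by
      simp only [hQw]
      exact (integrable_Q_f0 h hR (by rw [hα]; linarith) (by rw [hα]; linarith) hΩ
        (by linarith) hbx).div_const M
    have hj := jensen (g := fun y => Real.posLog (R / ‖y - x‖)) (t := α) hw0 hwi hw1
      (by
        simp only [hgw]
        exact (integrable_log_f0 h hR hΩ (by linarith) hbx).div_const M) hQi
    have h1 : p * u x ≤ p / kap * D + α * ∫ y, Real.posLog (R / ‖y - x‖) * w y := by
      simp only [hgw]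
      rw [integral_div]
      set I := ∫ y, Real.posLog (R / ‖y - x‖) * (ball x₀ r).indicator (f0 Ω u) y
      have h2 : α * (I / M) = p / kap * I := by
        rw [hM, hp]
        have : 2 - δ ≠ 0 := by linarith
        field_simp
      rw [h2, ← mul_add]
      have h3 : p * u x = p / kap * (kap * u x) := by field_simp
      rw [h3]
      apply mul_le_mul_of_nonneg_left _ (by positivity)
      linarith
    have h4 : Real.exp (p * u x) ≤
        E * (1 + ∫ y, Real.exp (α * Real.posLog (R / ‖y - x‖)) * w y) := by
      refine (Real.exp_le_exp.mpr h1).trans ?_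
      rw [Real.exp_add]
      exact mul_le_mul_of_nonneg_left hj (Real.exp_pos _).le
    refine (ENNReal.ofReal_le_ofReal h4).trans ?_
    rw [ENNReal.ofReal_mul (Real.exp_pos _).le, ENNReal.ofReal_add zero_le_one
      (integral_nonneg fun y => mul_nonneg (Real.exp_pos _).le (hw0 y)), ENNReal.ofReal_one,
      ofReal_integral_eq_lintegral_ofReal hQi
        (Eventually.of_forall fun y => mul_nonneg (Real.exp_pos _).le (hw0 y))]
    gcongr with y
    rw [ENNReal.ofReal_mul (Real.exp_pos _).le]
    rfl
  have hmeas : Measurable (Function.uncurry fun (x y : E2) =>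
      ENNReal.ofReal (Q R α (y - x)) * ENNReal.ofReal (w y)) := by
    have h1 := measurable_Q R α
    exact Measurable.mul (h1.comp (measurable_snd.sub measurable_fst)).ennreal_ofReal
      (hwm.comp measurable_snd).ennreal_ofReal
  have hmain : ∫⁻ x in ball x₀ (r / 2), ENNReal.ofReal (Real.exp (p * u x)) ≤ NN := by
    calc ∫⁻ x in ball x₀ (r / 2), ENNReal.ofReal (Real.exp (p * u x))
        ≤ ∫⁻ x in ball x₀ (r / 2), ENNReal.ofReal E *
          (1 + ∫⁻ y, ENNReal.ofReal (Q R α (y - x)) * ENNReal.ofReal (w y)) :=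
          setLIntegral_mono' measurableSet_ball hpt
      _ = ENNReal.ofReal E * (volume (ball x₀ (r / 2)) + ∫⁻ x in ball x₀ (r / 2),
            ∫⁻ y, ENNReal.ofReal (Q R α (y - x)) * ENNReal.ofReal (w y)) := by
          rw [lintegral_const_mul' _ _ ENNReal.ofReal_ne_top, lintegral_add_left measurable_const]
          simp
      _ ≤ NN := by
          rw [hNN, Measure.addHaar_ball_center]
          gcongr
          rw [lintegral_lintegral_swap hmeas.aemeasurable]
          calc ∫⁻ y, ∫⁻ x in ball x₀ (r / 2),
                ENNReal.ofReal (Q R α (y - x)) * ENNReal.ofReal (w y)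
              ≤ ∫⁻ y, J * ENNReal.ofReal (w y) := by
                apply lintegral_mono
                intro y
                simp only
                rw [lintegral_mul_const' _ _ ENNReal.ofReal_ne_top]
                by_cases hy : y ∈ ball x₀ r
                · gcongr
                  have hdy : dist y x₀ < r := hy
                  have hsub : ball x₀ (r / 2) ⊆ ball y R := by
                    apply ball_subset_ball'
                    rw [dist_comm]; linarith
                  refine (lintegral_mono_set hsub).trans ?_
                  rw [hJ, ← lintegral_indicator measurableSet_ball,
                    ← lintegral_indicator measurableSet_ball,
                    ← lintegral_sub_right_eq_self
                      ((ball (0 : E2) R).indicator fun z => ENNReal.ofReal (Q R α z)) y]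
                  apply le_of_eq
                  congr 1
                  ext x
                  simp only [indicator, mem_ball, dist_eq_norm, sub_zero, Q]
                  rw [norm_sub_rev y x]
                · have : w y = 0 := by simp only [w, indicator_of_notMem hy, zero_div]
                  simp [this]
            _ = J * ENNReal.ofReal (∫ y, w y) := by
                rw [lintegral_const_mul' _ _ hJfin.ne,
                  ofReal_integral_eq_lintegral_ofReal hwi (Eventually.of_forall hw0)]
            _ ≤ J * 1 := by
                gcongr
                exact ENNReal.ofReal_le_one.mpr hw1
            _ = J := mul_one J
  rw [integral_eq_lintegral_of_nonneg_ae (Eventually.of_forall fun x => (Real.exp_pos _).le)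
    hint.aestronglyMeasurable]
  exact ENNReal.toReal_mono hNNfin hmain

lemma young_exp {p q t a : ℝ} (hpq : p.HolderConjugate q) (ht : 0 ≤ t) :
    t * Real.exp a ≤ q ^ q * Real.exp t + Real.exp (p * a) := by
  have hp := hpq.lt
  have hq := hpq.symm.lt
  have hq0 : 0 < q := by linarith
  have h1 := Real.young_inequality_of_nonneg (Real.exp_pos a).le ht hpq
  have h2 : (Real.exp a) ^ p = Real.exp (p * a) := by rw [← Real.exp_mul, mul_comm]
  have h3 : t ^ q ≤ q ^ q * Real.exp t := by
    have h4 : t ≤ q * Real.exp (t / q) := by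
      have h5 := Real.add_one_le_exp (t / q)
      calc t = q * (t / q) := by field_simp
        _ ≤ q * Real.exp (t / q) := by gcongr; linarith
    calc t ^ q ≤ (q * Real.exp (t / q)) ^ q := Real.rpow_le_rpow ht h4 hq0.le
      _ = q ^ q * Real.exp t := by
        rw [Real.mul_rpow hq0.le (Real.exp_pos _).le, ← Real.exp_mul, div_mul_cancel₀ _ hq0.ne']
  have h5 : t ^ q / q ≤ t ^ q := div_le_self (Real.rpow_nonneg ht q) hq.le
  have h6 : (Real.exp a) ^ p / p ≤ (Real.exp a) ^ p :=
    div_le_self (Real.rpow_nonneg (Real.exp_pos _).le p) hp.le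
  linarith

lemma interior_bound {R b C : ℝ} (hR : 0 < R) (hC : 0 < C) :
    ∃ c : ℝ, ∀ (Ω : Set E2) (u : E2 → ℝ), Sol Ω b C u → ∀ x₀, closedBall x₀ (3 * R) ⊆ Ω →
      u x₀ ≤ c := by
  obtain ⟨r, δ, hr0, hrR, hδ, hδ1, hmass⟩ := mass_bound hR hC
  obtain ⟨p, N, hp, hexp⟩ := exp_bound (b := b) (C := C) hR hr0 hrR hδ hδ1
  set q := p.conjExponent with hq
  have hpq : p.HolderConjugate q := Real.HolderConjugate.conjExponent hp
  set J1 : ℝ := ∫ z in ball (0 : E2) R, Q R 1 z with hJ1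
  refine ⟨(b * (q ^ q * J1 + N) +
    (Real.posLog (R / (r / 2)) * (b * C) + 4 / R ^ 2 * C)) / kap, ?_⟩
  intro Ω u h x₀ hΩ
  obtain ⟨hei, heN⟩ := hexp Ω u h x₀ hΩ (hmass Ω b u h x₀ hΩ)
  have hsp := split h hR (σ := r / 2) (x := x₀) (by positivity) hΩ (r := r / 2) (by linarith)
    (ball_subset_ball (by linarith)) (by simp [hR.le]) (Subset.refl _)
  rw [le_div_iff₀ kap_pos, mul_comm]
  refine hsp.trans ?_
  gcongr ?_ + _
  have hq0 : 0 < q := by linarith [hpq.symm.lt]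
  have hQi := (integrableOn_Q hR zero_le_one one_lt_two le_rfl).integrable_indicator
    (measurableSet_ball (x := (0 : E2)) (ε := R))
  have hQi' := hQi.comp_sub_right x₀
  have hei' := hei.integrable_indicator measurableSet_ball
  have hJ1' : ∫ y, (ball (0 : E2) R).indicator (Q R 1) (y - x₀) = J1 := by
    rw [integral_sub_right_eq_self (fun y => (ball (0 : E2) R).indicator (Q R 1) y) x₀,
      integral_indicator measurableSet_ball]
  calc ∫ y, Real.posLog (R / ‖y - x₀‖) * (ball x₀ (r / 2)).indicator (f0 Ω u) y
      ≤ ∫ y, b * (q ^ q * (ball (0 : E2) R).indicator (Q R 1) (y - x₀) +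
          (ball x₀ (r / 2)).indicator (fun x => Real.exp (p * u x)) y) := by
        apply integral_mono (integrable_log_f0 h hR hΩ (by linarith)
          (ball_subset_ball (by linarith))) (((hQi'.const_mul _).add hei').const_mul b)
        intro y
        have hb := h.b_nonneg
        by_cases hy : y ∈ ball x₀ (r / 2)
        · have hd : dist y x₀ < r / 2 := hy
          have hyΩ : y ∈ Ω := hΩ (by rw [mem_closedBall]; linarith)
          have hyR : y - x₀ ∈ ball (0 : E2) R := by
            rw [mem_ball, dist_zero_right, ← dist_eq_norm]; linarith
          simp only [Pi.add_apply, indicator_of_mem hy, indicator_of_mem hyR]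
          have h1 := young_exp (a := u y) hpq (Real.posLog_nonneg (x := R / ‖y - x₀‖))
          calc Real.posLog (R / ‖y - x₀‖) * f0 Ω u y
              ≤ Real.posLog (R / ‖y - x₀‖) * (b * Real.exp (u y)) :=
                mul_le_mul_of_nonneg_left (f0_le h hyΩ) Real.posLog_nonneg
            _ = b * (Real.posLog (R / ‖y - x₀‖) * Real.exp (u y)) := by ring
            _ ≤ _ := by
                apply mul_le_mul_of_nonneg_left _ hb
                simpa [Q] using h1
        · simp only [Pi.add_apply, indicator_of_notMem hy, mul_zero, add_zero]
          apply mul_nonneg hb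
          apply mul_nonneg (Real.rpow_nonneg hq0.le _)
          exact indicator_nonneg (fun z _ => Q_nonneg _ _ _) _
    _ = b * (q ^ q * J1 + ∫ x in ball x₀ (r / 2), Real.exp (p * u x)) := by
        rw [integral_const_mul, integral_add (hQi'.const_mul _) hei', integral_const_mul, hJ1',
          integral_indicator measurableSet_ball]
    _ ≤ _ := by
        apply mul_le_mul_of_nonneg_left _ h.b_nonneg
        linarith

/-! ### Minimum principle and conclusion -/

lemma second_deriv_nonneg {f f' : ℝ → ℝ} {c : ℝ} (h1 : ∀ᶠ t in 𝓝 0, HasDerivAt f (f' t) t)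
    (h2 : HasDerivAt f' c 0) (hmin : IsLocalMin f 0) : 0 ≤ c := by
  by_contra hc
  push Not at hc
  have h3 : deriv f =ᶠ[𝓝 0] f' := h1.mono fun t ht => ht.deriv
  have h4 : deriv (deriv f) 0 = c := by rw [h3.deriv_eq, h2.deriv]
  have h5 : IsLocalMax f 0 := isLocalMax_of_deriv_deriv_neg (by rw [h4]; exact hc)
    hmin.deriv_eq_zero h1.self_of_nhds.continuousAt
  have h6 : f =ᶠ[𝓝 0] fun _ => f 0 := by
    filter_upwards [hmin, h5] with t ht1 ht2 using le_antisymm ht2 ht1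
  have h7 : deriv (deriv f) 0 = 0 := by
    rw [h6.deriv.deriv_eq]; simp
  linarith

lemma norm_sq_add (p : E2) (i : Fin 2) (t : ℝ) :
    ‖p + t • EuclideanSpace.single i (1 : ℝ)‖ ^ 2 = ‖p‖ ^ 2 + 2 * p i * t + t ^ 2 := by
  rw [norm_add_sq_real, inner_smul_right, norm_smul]
  simp [EuclideanSpace.inner_single_right]
  ring

lemma min_principle {Ω : Set E2} {u : E2 → ℝ} (hΩo : IsOpen Ω) (hΩb : Bornology.IsBounded Ω)
    (hu : ContDiffOn ℝ 2 u Ω) (huc : ContinuousOn u (closure Ω))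
    (hlap : ∀ x ∈ Ω, 0 ≤ -lap u x) (hbd : ∀ x ∈ frontier Ω, u x = 0) :
    ∀ x ∈ Ω, 0 ≤ u x := by
  intro x hx
  have hcpt : IsCompact (closure Ω) := hΩb.isCompact_closure
  obtain ⟨D, hD⟩ := hcpt.isBounded.exists_norm_le
  have key : ∀ δ : ℝ, 0 < δ → -(δ * D ^ 2) ≤ u x := by
    intro δ hδ
    obtain ⟨p, hp, hpmin⟩ := hcpt.exists_isMinOn ⟨x, subset_closure hx⟩
      (huc.sub (continuousOn_const.mul (continuous_norm.pow 2).continuousOn) :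
        ContinuousOn (fun y => u y - δ * ‖y‖ ^ 2) (closure Ω))
    have hpn : p ∉ Ω := by
      intro hpΩ
      have h2 : ∀ i : Fin 2, 2 * δ ≤ fderiv ℝ
          (fun y => fderiv ℝ u y (EuclideanSpace.single i 1)) p (EuclideanSpace.single i 1) := by
        intro i
        set e : E2 := EuclideanSpace.single i 1 with he
        have hline : ∀ t : ℝ, HasDerivAt (fun s : ℝ => p + s • e) e t := fun t => by
          simpa using ((hasDerivAt_id t).smul_const e).const_add p
        have hcont : Continuous (fun s : ℝ => p + s • e) := by fun_prop
        have hev : ∀ᶠ t : ℝ in 𝓝 0, p + t • e ∈ Ω := by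
          apply hcont.continuousAt.eventually_mem
          apply hΩo.mem_nhds
          simpa using hpΩ
        have hquad : ∀ t : ℝ, HasDerivAt (fun s : ℝ => δ * ‖p + s • e‖ ^ 2)
            (δ * (2 * p i + 2 * t)) t := by
          intro t
          simp only [he, norm_sq_add]
          have := ((((hasDerivAt_id t).const_mul (2 * p i)).const_add (‖p‖ ^ 2)).add
            ((hasDerivAt_id t).pow 2)).const_mul δ
          exact this.congr_deriv (by simp)
        have hlin : HasDerivAt (fun t : ℝ => δ * (2 * p i + 2 * t)) (δ * 2) 0 := by
          have := (((hasDerivAt_id (0 : ℝ)).const_mul 2).const_add (2 * p i)).const_mul δ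
          simpa using this
        have h1 : ContDiffOn ℝ 1 (fun y => fderiv ℝ u y e) Ω :=
          (hu.fderiv_of_isOpen hΩo (by norm_num)).clm_apply contDiffOn_const
        have hd1 : ∀ y ∈ Ω, DifferentiableAt ℝ u y := fun y hy =>
          (hu.differentiableOn (by norm_num)).differentiableAt (hΩo.mem_nhds hy)
        have hd2 : DifferentiableAt ℝ (fun y => fderiv ℝ u y e) p :=
          (h1.differentiableOn (by norm_num)).differentiableAt (hΩo.mem_nhds hpΩ)
        have := second_deriv_nonneg (f := fun t : ℝ => u (p + t • e) - δ * ‖p + t • e‖ ^ 2)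
          (f' := fun t => fderiv ℝ u (p + t • e) e - δ * (2 * p i + 2 * t))
          (c := fderiv ℝ (fun y => fderiv ℝ u y e) p e - δ * 2) ?_ ?_ ?_
        · linarith
        · filter_upwards [hev] with t ht
          exact ((hd1 _ ht).hasFDerivAt.comp_hasDerivAt t (hline t)).sub (hquad t)
        · refine HasDerivAt.sub ?_ hlin
          have h3 : HasFDerivAt (fun y => fderiv ℝ u y e)
              (fderiv ℝ (fun y => fderiv ℝ u y e) p) (p + (0 : ℝ) • e) := by
            simpa using hd2.hasFDerivAt
          exact h3.comp_hasDerivAt (0 : ℝ) (hline 0)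
        · filter_upwards [hev] with t ht
          have := hpmin (subset_closure ht)
          simpa using this
      have h3 := hlap p hpΩ
      unfold lap at h3
      rw [Fin.sum_univ_two] at h3
      have := h2 0
      have := h2 1
      linarith
    have hpf : p ∈ frontier Ω := by
      rw [frontier, hΩo.interior_eq]; exact ⟨hp, hpn⟩
    have h4 : u p - δ * ‖p‖ ^ 2 ≤ u x - δ * ‖x‖ ^ 2 := hpmin (subset_closure hx)
    rw [hbd p hpf] at h4
    have h5 : ‖p‖ ^ 2 ≤ D ^ 2 := pow_le_pow_left₀ (norm_nonneg _) (hD p hp) 2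
    have h6 := mul_le_mul_of_nonneg_left h5 hδ.le
    have h7 : 0 ≤ δ * ‖x‖ ^ 2 := by positivity
    linarith
  by_contra hneg
  push Not at hneg
  have h8 := key (-u x / (2 * (D ^ 2 + 1))) (by apply div_pos <;> [linarith; positivity])
  have h9 : -u x / (2 * (D ^ 2 + 1)) * D ^ 2 ≤ -u x / 2 := by
    rw [div_mul_eq_mul_div, div_le_div_iff₀ (by positivity) (by norm_num)]
    nlinarith
  linarith

end BM

/-- **Theorem B (Brezis–Merle).** Interior bound for the Liouville equation `-Δu = V e^u`
with Dirichlet boundary condition, `0 ≤ V ≤ b` and bounded energy `∫_Ω e^u ≤ C`. -/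
theorem brezis_merle_theoremB (Ω : Set E2) (hΩo : IsOpen Ω) (hΩb : Bornology.IsBounded Ω)
    (hΩs : SmoothBoundary Ω) (b C : ℝ) (hb : 0 ≤ b) (hC : 0 < C)
    (K : Set E2) (hK : IsCompact K) (hKΩ : K ⊆ Ω) :
    ∃ c : ℝ, ∀ (V u : E2 → ℝ),
      ContDiffOn ℝ 2 u (closure Ω) →
      (∀ x ∈ Ω, 0 ≤ V x ∧ V x ≤ b) →
      (∀ x ∈ Ω, -lap u x = V x * Real.exp (u x)) →
      (∀ x ∈ frontier Ω, u x = 0) →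
      (∫ x in Ω, Real.exp (u x)) ≤ C →
      ∀ x ∈ K, u x ≤ c := by
  obtain ⟨d, hd, hdΩ⟩ := hK.exists_cthickening_subset_open hΩo hKΩ
  obtain ⟨c, hc⟩ := BM.interior_bound (R := d / 3) (b := b) (C := C) (by positivity) hC
  refine ⟨c, fun V u hu hV heq hbd hint x hx => ?_⟩
  have hus : ContDiffOn ℝ 2 u Ω := hu.mono subset_closure
  have hl0 : ∀ y ∈ Ω, 0 ≤ -lap u y := fun y hy => by
    rw [heq y hy]; exact mul_nonneg (hV y hy).1 (Real.exp_pos _).le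
  have hsol : BM.Sol Ω b C u :=
    { open_ := hΩo
      smooth := hus
      nonneg := BM.min_principle hΩo hΩb hus hu.continuousOn hl0 hbd
      lap_nonneg := hl0
      lap_le := fun y hy => by
        rw [heq y hy]
        exact mul_le_mul_of_nonneg_right (hV y hy).2 (Real.exp_pos _).le
      int := ((Real.continuous_exp.comp_continuousOn hu.continuousOn).integrableOn_compact
        hΩb.isCompact_closure).mono_set subset_closure
      int_le := hint
      b_nonneg := hb }
  apply hc Ω u hsol x
  rw [show 3 * (d / 3) = d by ring]
  exact (closedBall_subset_cthickening hx d).trans hdΩ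
end
end

section
/- There exist a bounded open set Ω ⊂ ℝ² with smooth boundary, constants 0 ≤ b < +∞ and C > 0, and sequences of functions (u_i) in C²(Ω̄) and (V_i) with 0 ≤ V_i ≤ b on Ω, such that -Δu_i = V_i e^{u_i} in Ω, u_i = 0 on ∂Ω, ∫_Ω e^{u_i} dx ≤ C for all i, and yet sup_Ω u_i → +∞ as i → ∞. -/
open MeasureTheory Real Filter Topology Metric Set
open scoped RealInnerProductSpace ENNReal NNReal

noncomputable section

/-- The quadratic `a‖x‖² - 2⟪p,x⟫ + c`. -/
def QQ (a c : ℝ) (p x : E2) : ℝ := a * ‖x‖ ^ 2 - 2 * ⟪p, x⟫ + c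

lemma QQ_contDiff (a c : ℝ) (p : E2) : ContDiff ℝ 2 (QQ a c p) := by
  unfold QQ
  exact ((contDiff_const.mul (contDiff_norm_sq ℝ)).sub
    (contDiff_const.mul (contDiff_const.inner ℝ contDiff_id))).add contDiff_const

lemma QQ_hasFDerivAt (a c : ℝ) (p x : E2) :
    HasFDerivAt (QQ a c p)
      (a • (2 • innerSL ℝ x) - (2:ℝ) • innerSL ℝ p) x := by
  have h1 : HasFDerivAt (fun x : E2 => ‖x‖ ^ 2) (2 • innerSL ℝ x) x :=
    (hasStrictFDerivAt_norm_sq x).hasFDerivAt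
  have h2 : HasFDerivAt (fun x : E2 => ⟪p, x⟫) (innerSL ℝ p) x :=
    (innerSL ℝ p).hasFDerivAt
  exact ((h1.const_mul a).sub (h2.const_mul 2)).add_const c

/-- The function `2 (log B - log A)`. -/
def UU (a c a' c' : ℝ) (p x : E2) : ℝ := 2 * (Real.log (QQ a c p x) - Real.log (QQ a' c' p x))

lemma logQQ_fderiv (a c : ℝ) (p y v : E2) (h : 0 < QQ a c p y) :
    HasFDerivAt (fun y => Real.log (QQ a c p y))
      ((QQ a c p y)⁻¹ • (a • (2 • innerSL ℝ y) - (2:ℝ) • innerSL ℝ p)) y :=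
  (QQ_hasFDerivAt a c p y).log h.ne'

lemma dlog_fderiv (a c : ℝ) (p x v : E2) (h : 0 < QQ a c p x) :
    HasFDerivAt (fun y => (QQ a c p y)⁻¹ * (2 * a * ⟪v, y⟫ - 2 * ⟪p, v⟫))
      ((QQ a c p x)⁻¹ • ((2 * a) • innerSL ℝ v) + (2 * a * ⟪v, x⟫ - 2 * ⟪p, v⟫) •
        ((-(QQ a c p x ^ 2)⁻¹) • (a • (2 • innerSL ℝ x) - (2:ℝ) • innerSL ℝ p))) x := by
  have h1 := (hasDerivAt_inv h.ne').comp_hasFDerivAt x (QQ_hasFDerivAt a c p x)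
  have h2 : HasFDerivAt (fun x : E2 => ⟪v, x⟫) (innerSL ℝ v) x :=
    (innerSL ℝ v).hasFDerivAt
  have h3 := (h2.const_mul (2 * a)).sub_const (2 * ⟪p, v⟫)
  exact h1.mul h3

lemma lap_UU (a c a' c' : ℝ) (p x : E2) (h : ∀ y, 0 < QQ a c p y) (h' : ∀ y, 0 < QQ a' c' p y) :
    lap (UU a c a' c' p) x =
      8 * (a * c - ‖p‖ ^ 2) / QQ a c p x ^ 2 - 8 * (a' * c' - ‖p‖ ^ 2) / QQ a' c' p x ^ 2 := by
  have e1 : ∀ v : E2, (fun y => fderiv ℝ (UU a c a' c' p) y v) = fun y =>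
      2 * ((QQ a c p y)⁻¹ * (2 * a * ⟪v, y⟫ - 2 * ⟪p, v⟫)
       - (QQ a' c' p y)⁻¹ * (2 * a' * ⟪v, y⟫ - 2 * ⟪p, v⟫)) := by
    intro v
    ext y
    have := ((logQQ_fderiv a c p y v (h y)).sub (logQQ_fderiv a' c' p y v (h' y))).const_mul 2
    have e : HasFDerivAt (UU a c a' c' p) _ y := this
    rw [e.fderiv]
    simp [real_inner_comm v y]
    ring
  have e2 : ∀ v : E2, fderiv ℝ (fun y => fderiv ℝ (UU a c a' c' p) y v) x v = 
      2 * ((QQ a c p x)⁻¹ * (2 * a * ⟪v, v⟫) - (2 * a * ⟪v, x⟫ - 2 * ⟪p, v⟫) ^ 2 / QQ a c p x ^ 2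
       - ((QQ a' c' p x)⁻¹ * (2 * a' * ⟪v, v⟫)
         - (2 * a' * ⟪v, x⟫ - 2 * ⟪p, v⟫) ^ 2 / QQ a' c' p x ^ 2)) := by
    intro v
    rw [e1 v]
    have := ((dlog_fderiv a c p x v (h x)).sub (dlog_fderiv a' c' p x v (h' x))).const_mul 2
    refine (congrArg (fun L : E2 →L[ℝ] ℝ => L v) (HasFDerivAt.fderiv this)).trans ?_
    simp only [ContinuousLinearMap.smul_apply, ContinuousLinearMap.sub_apply,
      ContinuousLinearMap.add_apply, innerSL_apply_apply, smul_eq_mul, nsmul_eq_mul,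
      real_inner_comm v x]
    push_cast
    ring
  have key : ∀ a c : ℝ, 0 < QQ a c p x → ∑ i : Fin 2, ((QQ a c p x)⁻¹ *
      (2 * a * ⟪EuclideanSpace.single i (1:ℝ), (EuclideanSpace.single i (1:ℝ) : E2)⟫)
        - (2 * a * ⟪EuclideanSpace.single i (1:ℝ), x⟫ -
          2 * ⟪p, EuclideanSpace.single i (1:ℝ)⟫) ^ 2 / QQ a c p x ^ 2)
      = 4 * (a * c - ‖p‖ ^ 2) / QQ a c p x ^ 2 := by
    intro a c hq
    have hne := hq.ne'
    have hQ : QQ a c p x = a * (x 0 ^ 2 + x 1 ^ 2) - 2 * (p 0 * x 0 + p 1 * x 1) + c := by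
      simp [QQ, EuclideanSpace.real_norm_sq_eq, PiLp.inner_apply, Fin.sum_univ_two]
      ring
    have hp : ‖p‖ ^ 2 = p 0 ^ 2 + p 1 ^ 2 := by
      simp [EuclideanSpace.real_norm_sq_eq, Fin.sum_univ_two]
    rw [hp]
    simp only [Fin.sum_univ_two, EuclideanSpace.inner_single_left, EuclideanSpace.inner_single_right]
    simp
    have e : (QQ a c p x)⁻¹ = QQ a c p x / QQ a c p x ^ 2 := by field_simp
    rw [e, div_mul_eq_mul_div, ← sub_div, ← sub_div, ← add_div]
    congr 1
    rw [hQ]; ring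
  unfold lap
  simp_rw [e2, ← Finset.mul_sum]
  rw [Finset.sum_sub_distrib, key a c (h x), key a' c' (h' x)]
  ring

lemma ball_smooth : SmoothBoundary (ball (0 : E2) 1) := by
  intro x hx
  rw [frontier_ball _ one_ne_zero] at hx
  have hd : ∀ y : E2, HasFDerivAt (fun y : E2 => ‖y‖ ^ 2 - 1) (2 • innerSL ℝ y) y :=
    fun y => (hasStrictFDerivAt_norm_sq y).hasFDerivAt.sub_const 1
  refine ⟨{0}ᶜ, fun y => ‖y‖ ^ 2 - 1, isOpen_compl_singleton, ?_, ?_, ?_, ?_, ?_⟩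
  · rintro rfl
    simp at hx
  · exact (contDiff_norm_sq ℝ).sub contDiff_const
  · intro y hy h0
    rw [(hd y).fderiv] at h0
    have := congrArg (fun L => L y) h0
    simp at this
    exact hy this
  · ext y
    simp only [mem_inter_iff, mem_ball_zero_iff, mem_ofPred_eq]
    rw [and_comm]
    refine and_congr_right fun _ => ?_
    rw [sub_neg, sq_lt_one_iff₀ (norm_nonneg y)]
  · ext y
    rw [frontier_ball _ one_ne_zero]
    simp only [mem_inter_iff, mem_sphere_zero_iff_norm, mem_ofPred_eq]
    rw [and_comm]
    refine and_congr_right fun _ => ?_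
    rw [sub_eq_zero, pow_eq_one_iff_of_nonneg (norm_nonneg y) two_ne_zero]

lemma bubble_integrable : Integrable (fun x : E2 => ((1 + ‖x‖ ^ 2) ^ 2)⁻¹) := by
  have := integrable_rpow_neg_one_add_norm_sq (E := E2) (μ := volume) (r := 4) (by simp; norm_num)
  refine this.congr (Eventually.of_forall fun x => ?_)
  have h : (0:ℝ) ≤ 1 + ‖x‖ ^ 2 := by positivity
  simp only
  rw [show (-4 / 2 : ℝ) = -((2:ℕ):ℝ) by norm_num, Real.rpow_neg h, Real.rpow_natCast]

lemma bubble_scale (ε : ℝ) (hε : 0 < ε) (p : E2) :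
    Integrable (fun x : E2 => ε ^ 2 / (ε ^ 2 + ‖x - p‖ ^ 2) ^ 2) ∧
    ∫ x : E2, ε ^ 2 / (ε ^ 2 + ‖x - p‖ ^ 2) ^ 2 = ∫ x : E2, ((1 + ‖x‖ ^ 2) ^ 2)⁻¹ := by
  have e : (fun x : E2 => ε ^ 2 / (ε ^ 2 + ‖x‖ ^ 2) ^ 2) =
      fun x => (ε ^ 2)⁻¹ * ((1 + ‖ε⁻¹ • x‖ ^ 2) ^ 2)⁻¹ := by
    ext x
    rw [norm_smul, norm_inv, Real.norm_of_nonneg hε.le]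
    have : ε ^ 2 + ‖x‖ ^ 2 ≠ 0 := by positivity
    have h2 : (1 + (ε⁻¹ * ‖x‖) ^ 2) = (ε ^ 2 + ‖x‖ ^ 2) / ε ^ 2 := by field_simp
    rw [h2]
    field_simp
  have hi : Integrable (fun x : E2 => ε ^ 2 / (ε ^ 2 + ‖x‖ ^ 2) ^ 2) := by
    rw [e]
    exact (bubble_integrable.comp_smul (inv_ne_zero hε.ne')).const_mul _
  refine ⟨hi.comp_sub_right p, ?_⟩
  rw [integral_sub_right_eq_self (fun x : E2 => ε ^ 2 / (ε ^ 2 + ‖x‖ ^ 2) ^ 2) p, e,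
    integral_const_mul, Measure.integral_comp_smul volume (fun x : E2 => ((1 + ‖x‖ ^ 2) ^ 2)⁻¹)]
  simp
  field_simp

/-- All properties for a single `d`. -/
lemma single_step (d : ℝ) (hd : 0 < d) (hd1 : d < 1) :
    ∃ u : E2 → ℝ, ContDiff ℝ 2 u ∧
      (∀ x ∈ ball (0:E2) 1, 0 ≤ -lap u x ∧ -lap u x ≤ 8 * Real.exp (u x)) ∧
      (∀ x ∈ sphere (0:E2) 1, u x = 0) ∧
      (∫ x in ball (0:E2) 1, Real.exp (u x)) ≤ 8 * volume.real (ball (0:E2) 1) +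
        128 * ∫ x : E2, ((1 + ‖x‖ ^ 2) ^ 2)⁻¹ ∧
      2 * Real.log (1 / d ^ 2) ≤ sSup (u '' ball (0:E2) 1) := by
  obtain ⟨p, hp⟩ : ∃ p : E2, ‖p‖ = 1 - d :=
    ⟨EuclideanSpace.single 0 (1 - d), by simp; linarith⟩
  set α : ℝ := ‖p‖ ^ 2 + d ^ 4 with hα
  have hαpos : 0 < α := by positivity
  have hd4 : d ^ 4 ≤ d := by
    simpa using pow_le_pow_of_le_one hd.le hd1.le (show 1 ≤ 4 by norm_num)
  have hd42 : d ^ 4 ≤ d ^ 2 := pow_le_pow_of_le_one hd.le hd1.le (by norm_num)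
  have hA : ∀ x, QQ 1 α p x = (d ^ 2) ^ 2 + ‖x - p‖ ^ 2 := by
    intro x
    rw [norm_sub_sq_real, real_inner_comm]; simp only [QQ, hα]; ring
  have hApos : ∀ x, 0 < QQ 1 α p x := fun x => by rw [hA]; positivity
  have hin : ∀ x, ⟪p, x⟫ ≤ ‖p‖ * ‖x‖ := fun x => real_inner_le_norm p x
  have hBpos : ∀ x, 0 < QQ α 1 p x := by
    intro x
    have := hin x
    have h4 : 0 < d ^ 4 := by positivity
    rcases eq_or_ne x 0 with rfl | hx
    · simp [QQ]
    · have : 0 < d ^ 4 * ‖x‖ ^ 2 := by positivity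
      simp only [QQ, hα]
      nlinarith [sq_nonneg (‖p‖ * ‖x‖ - 1)]
  have hB : ∀ x, ‖x‖ ≤ 1 → d ^ 2 ≤ QQ α 1 p x := by
    intro x hx
    have h1 := hin x
    have h2 : 0 ≤ d ^ 4 * ‖x‖ ^ 2 := by positivity
    have h3 : d ≤ 1 - ‖p‖ * ‖x‖ := by
      nlinarith [norm_nonneg p]
    have h5 : d ^ 2 ≤ (1 - ‖p‖ * ‖x‖) ^ 2 := pow_le_pow_left₀ hd.le h3 2
    simp only [QQ, hα]
    nlinarith
  have hBA : ∀ x, QQ α 1 p x = QQ 1 α p x + (1 - ‖x‖ ^ 2) * (1 - α) := by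
    intro x; simp only [QQ]; ring
  have hα1 : 0 ≤ 1 - α ∧ 1 - α ≤ 2 * d := by
    rw [hα, hp]; constructor <;> nlinarith [pow_pos hd 4]
  have hexp : ∀ x, Real.exp (UU α 1 1 α p x) = QQ α 1 p x ^ 2 / QQ 1 α p x ^ 2 := by
    intro x
    unfold UU
    rw [← Real.log_div (hBpos x).ne' (hApos x).ne', ← div_pow, mul_comm, Real.exp_mul,
      Real.exp_log (div_pos (hBpos x) (hApos x))]
    norm_cast
  have hcd : ContDiff ℝ 2 (UU α 1 1 α p) := by
    unfold UU
    exact contDiff_const.mul (((QQ_contDiff α 1 p).log fun x => (hBpos x).ne').sub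
      ((QQ_contDiff 1 α p).log fun x => (hApos x).ne'))
  have hlap : ∀ x, -lap (UU α 1 1 α p) x =
      8 * d ^ 4 * (1 / QQ 1 α p x ^ 2 - 1 / QQ α 1 p x ^ 2) := by
    intro x
    rw [lap_UU _ _ _ _ p x hBpos hApos, hα]; ring
  refine ⟨UU α 1 1 α p, hcd, ?_, ?_, ?_, ?_⟩
  · intro x hx
    have hx1 : ‖x‖ < 1 := by simpa using hx
    have hA0 := hApos x
    have hB0 := hBpos x
    have hle : QQ 1 α p x ≤ QQ α 1 p x := by
      rw [hBA]
      have : 0 ≤ 1 - ‖x‖ ^ 2 := by nlinarith [norm_nonneg x]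
      nlinarith [mul_nonneg this hα1.1]
    have hBd := hB x hx1.le
    rw [hlap, hexp]
    generalize QQ 1 α p x = A at *
    generalize QQ α 1 p x = B at *
    constructor
    · have : 1 / B ^ 2 ≤ 1 / A ^ 2 := by gcongr
      have h4 : 0 < d ^ 4 := by positivity
      exact mul_nonneg (by positivity) (by linarith)
    · have h4 : d ^ 4 ≤ B ^ 2 := by
        calc d ^ 4 = (d ^ 2) ^ 2 := by ring
          _ ≤ B ^ 2 := by gcongr
      calc 8 * d ^ 4 * (1 / A ^ 2 - 1 / B ^ 2) ≤ 8 * d ^ 4 * (1 / A ^ 2) := by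
            gcongr
            have : 0 < 1 / B ^ 2 := by positivity
            linarith
        _ ≤ 8 * B ^ 2 * (1 / A ^ 2) := by gcongr
        _ = _ := by ring
  · intro x hx
    have hx1 : ‖x‖ = 1 := by simpa using hx
    unfold UU
    rw [hBA, hx1]; simp
  · obtain ⟨hi, he⟩ := bubble_scale (d ^ 2) (by positivity) p
    have hfin : volume (ball (0:E2) 1) ≠ ⊤ := measure_ball_lt_top.ne
    have hcont : Continuous fun x => Real.exp (UU α 1 1 α p x) :=
      Real.continuous_exp.comp hcd.continuous
    have hint : IntegrableOn (fun x => Real.exp (UU α 1 1 α p x)) (ball (0:E2) 1) :=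
      (hcont.continuousOn.integrableOn_compact (isCompact_closedBall (0:E2) 1)).mono_set
        ball_subset_closedBall
    have hc : IntegrableOn (fun _ : E2 => (8:ℝ)) (ball (0:E2) 1) := integrableOn_const hfin
    calc (∫ x in ball (0:E2) 1, Real.exp (UU α 1 1 α p x))
        ≤ ∫ x in ball (0:E2) 1,
          (8 + 128 * ((d ^ 2) ^ 2 / ((d ^ 2) ^ 2 + ‖x - p‖ ^ 2) ^ 2)) := by
          refine setIntegral_mono_on hint (hc.add (hi.integrableOn.const_mul 128))
            measurableSet_ball fun x hx => ?_
          have hx1 : ‖x‖ < 1 := by simpa using hx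
          have hA0 := hApos x
          have hB0 := hBpos x
          have hr : 1 - d - ‖x‖ ≤ ‖x - p‖ := by
            rw [← hp, norm_sub_rev]; exact norm_sub_norm_le p x
          have hBle : QQ α 1 p x ≤ 2 * QQ 1 α p x + 8 * d ^ 2 := by
            have k1 : 1 - ‖x‖ ^ 2 ≤ 2 * (d + ‖x - p‖) := by nlinarith [norm_nonneg x]
            have k2 : (1 - ‖x‖ ^ 2) * (1 - α) ≤ 2 * (d + ‖x - p‖) * (2 * d) :=
              mul_le_mul k1 hα1.2 hα1.1 (by positivity)
            rw [hBA]
            have := hA x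
            nlinarith [sq_nonneg (‖x - p‖ - 2 * d), pow_pos hd 4]
          rw [hexp, ← hA]
          generalize QQ 1 α p x = A at *
          generalize QQ α 1 p x = B at *
          have : B ^ 2 ≤ 8 * A ^ 2 + 128 * (d ^ 2) ^ 2 := by
            have : B ^ 2 ≤ (2 * A + 8 * d ^ 2) ^ 2 := by gcongr
            nlinarith [sq_nonneg (2 * A - 8 * d ^ 2)]
          rw [div_le_iff₀ (by positivity)]
          refine this.trans (le_of_eq ?_)
          field_simp
      _ = 8 * volume.real (ball (0:E2) 1) + 128 * ∫ x in ball (0:E2) 1,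
            (d ^ 2) ^ 2 / ((d ^ 2) ^ 2 + ‖x - p‖ ^ 2) ^ 2 := by
          rw [integral_add hc (hi.integrableOn.const_mul 128), integral_const_mul]
          simp [mul_comm]
      _ ≤ _ := by
          rw [← he]
          gcongr
          · exact Eventually.of_forall fun x => by positivity
          · exact Measure.restrict_le_self
  · have hpm : p ∈ ball (0:E2) 1 := by simp [hp, hd]
    have hbdd : BddAbove (UU α 1 1 α p '' ball (0:E2) 1) :=
      ((isCompact_closedBall (0:E2) 1).bddAbove_image hcd.continuous.continuousOn).mono
        (image_mono ball_subset_closedBall)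
    refine le_trans ?_ (le_csSup hbdd (mem_image_of_mem _ hpm))
    unfold UU
    rw [← Real.log_div (hBpos p).ne' (hApos p).ne']
    have h1 : QQ 1 α p p = d ^ 4 := by rw [hA]; simp; ring
    have h2 := hB p (by linarith)
    rw [h1]
    refine mul_le_mul_of_nonneg_left (Real.log_le_log (by positivity) ?_) (by norm_num)
    rw [div_le_div_iff₀ (by positivity) (by positivity)]
    calc 1 * d ^ 4 = d ^ 2 * d ^ 2 := by ring
      _ ≤ _ := by gcongr

theorem brezis_merle_theoremC :
    ∃ (Ω : Set E2), IsOpen Ω ∧ Bornology.IsBounded Ω ∧ SmoothBoundary Ω ∧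
    ∃ (b C : ℝ) (u V : ℕ → E2 → ℝ), 0 ≤ b ∧ 0 < C ∧
      (∀ i, ContDiffOn ℝ 2 (u i) (closure Ω)) ∧
      (∀ i, ∀ x ∈ Ω, 0 ≤ V i x ∧ V i x ≤ b) ∧
      (∀ i, ∀ x ∈ Ω, -lap (u i) x = V i x * Real.exp (u i x)) ∧
      (∀ i, ∀ x ∈ frontier Ω, u i x = 0) ∧
      (∀ i, (∫ x in Ω, Real.exp (u i x)) ≤ C) ∧
      Tendsto (fun i => sSup (u i '' Ω)) atTop atTop := by
  have hstep := fun i : ℕ => single_step (1 / ((i:ℝ) + 2)) (by positivity)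
    (by rw [div_lt_one (by positivity)]; linarith [(Nat.cast_nonneg i : (0:ℝ) ≤ i)])
  choose u h1 h2 h3 h4 h5 using hstep
  refine ⟨ball 0 1, isOpen_ball, isBounded_ball, ball_smooth, 8,
    8 * volume.real (ball (0:E2) 1) + 128 * ∫ x : E2, ((1 + ‖x‖ ^ 2) ^ 2)⁻¹, u,
    fun i x => -lap (u i) x / Real.exp (u i x), by norm_num, ?_, fun i => (h1 i).contDiffOn,
    ?_, ?_, ?_, h4, ?_⟩
  · have hb : 0 < volume.real (ball (0:E2) 1) :=
      ENNReal.toReal_pos (measure_ball_pos volume _ one_pos).ne' measure_ball_lt_top.ne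
    have : 0 ≤ ∫ x : E2, ((1 + ‖x‖ ^ 2) ^ 2)⁻¹ := integral_nonneg fun x => by positivity
    positivity
  · intro i x hx
    obtain ⟨ha, hb⟩ := h2 i x hx
    exact ⟨div_nonneg ha (Real.exp_pos _).le, (div_le_iff₀ (Real.exp_pos _)).2 hb⟩
  · intro i x hx
    exact (div_mul_cancel₀ _ (Real.exp_pos _).ne').symm
  · intro i x hx
    rw [frontier_ball _ one_ne_zero] at hx
    exact h3 i x hx
  · refine tendsto_atTop_mono h5 ?_
    have e : (fun i : ℕ => 2 * Real.log (1 / (1 / ((i:ℝ) + 2)) ^ 2)) =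
        fun i : ℕ => 4 * Real.log ((i:ℝ) + 2) := by
      ext i
      rw [one_div_pow, one_div_one_div, Real.log_pow]; push_cast; ring
    rw [e]
    exact (Real.tendsto_log_atTop.comp
      (tendsto_atTop_add_const_right _ 2 tendsto_natCast_atTop_atTop)).const_mul_atTop
      (by norm_num)
end
end

section
/- Let Ω ⊂ ℝ² be a bounded open set with smooth boundary and let C₀ > 0. For each q with 1 < q < 2 there exists a constant C_q = C_q(C₀, q, Ω) such that every u ∈ C²(Ω̄) with u = 0 on ∂Ω and ‖Δu‖_{L¹(Ω)} ≤ C₀ satisfies ‖∇u‖_{L^q(Ω)} ≤ C_q. -/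
open MeasureTheory Real Filter Topology Metric Set
open scoped RealInnerProductSpace ENNReal NNReal

noncomputable section

/-- Square of the positive part is differentiable. -/
lemma hasDerivAt_posSq (ε t : ℝ) :
    HasDerivAt (fun t : ℝ => (max (t - ε) 0) ^ 2) (2 * max (t - ε) 0) t := by
  rcases lt_trichotomy t ε with h | h | h
  · have : (fun t : ℝ => (max (t - ε) 0) ^ 2) =ᶠ[𝓝 t] fun _ => 0 := by
      filter_upwards [Iio_mem_nhds h] with y hy
      rw [max_eq_right (by linarith [mem_Iio.1 hy])]; norm_num
    rw [max_eq_right (by linarith)]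
    simpa using (hasDerivAt_const t (0:ℝ)).congr_of_eventuallyEq this
  · subst h
    simp only [sub_self, max_self, mul_zero]
    rw [hasDerivAt_iff_isLittleO]
    simp only [sub_self, max_self, smul_zero, sub_zero, ne_eq, OfNat.ofNat_ne_zero,
      not_false_eq_true, zero_pow]
    have h1 : (fun x : ℝ => max (x - t) 0 ^ 2) =O[𝓝 t] fun x => (x - t) ^ 2 := by
      apply Asymptotics.IsBigO.of_bound 1
      filter_upwards with x
      rw [one_mul, norm_pow, norm_pow]
      gcongr
      simp only [Real.norm_eq_abs]
      rcases le_total (x - t) 0 with h | h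
      · rw [max_eq_right h]; simp
      · rw [max_eq_left h]
    refine h1.trans_isLittleO ?_
    have h2 : (fun x : ℝ => (x - t) ^ 2) =o[𝓝 t] fun x => (x - t) ^ 1 := by
      have := (Asymptotics.isLittleO_pow_pow (𝕜 := ℝ) (m := 1) (n := 2) (by norm_num))
      have h3 : Tendsto (fun x : ℝ => x - t) (𝓝 t) (𝓝 0) := by
        have : Continuous (fun x : ℝ => x - t) := by fun_prop
        simpa using this.tendsto t
      exact this.comp_tendsto h3
    simpa using h2
  · have : (fun t : ℝ => (max (t - ε) 0) ^ 2) =ᶠ[𝓝 t] fun t => (t - ε) ^ 2 := by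
      filter_upwards [Ioi_mem_nhds h] with y hy
      rw [max_eq_left (by linarith [mem_Ioi.1 hy])]
    rw [max_eq_left (by linarith)]
    have h2 : HasDerivAt (fun t : ℝ => (t - ε) ^ 2) (2 * (t - ε)) t := by
      have := ((hasDerivAt_id t).sub_const ε).fun_pow 2
      simpa using this
    exact h2.congr_of_eventuallyEq this

lemma exists_trunc (ε : ℝ) (hε : 0 < ε) : ∃ k k' : ℝ → ℝ, (∀ t, HasDerivAt k (k' t) t) ∧
    Continuous k' ∧ (∀ t ≤ ε, k t = 0) ∧ (∀ t, 0 ≤ k t) ∧ (∀ t, 0 ≤ k' t) ∧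
    (∀ t, k' t * (1 + k t) ^ 2 ≤ 1) ∧ (∀ t, 2 * ε ≤ t → 1 / 8 ≤ k' t * (1 + k t) ^ 2) := by
  set s : ℝ → ℝ := fun t => max (t - ε) 0 with hs
  set g : ℝ → ℝ := fun t => √(ε ^ 2 + s t ^ 2) - ε with hg
  set g' : ℝ → ℝ := fun t => s t / √(ε ^ 2 + s t ^ 2) with hg'
  have hs0 : ∀ t, 0 ≤ s t := fun t => le_max_right _ _
  have hsc : Continuous s := by fun_prop
  have hp : ∀ t, 0 < ε ^ 2 + s t ^ 2 := fun t => by positivity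
  have hsq : ∀ t, 0 < √(ε ^ 2 + s t ^ 2) := fun t => Real.sqrt_pos.2 (hp t)
  have hg0 : ∀ t, 0 ≤ g t := fun t => by
    have : ε ≤ √(ε ^ 2 + s t ^ 2) := Real.le_sqrt_of_sq_le (by nlinarith [sq_nonneg (s t)])
    show 0 ≤ √(ε ^ 2 + s t ^ 2) - ε
    linarith
  have hgd : ∀ t, HasDerivAt g (g' t) t := fun t => by
    have h1 := ((hasDerivAt_posSq ε t).const_add (ε ^ 2)).sqrt (hp t).ne'
    have h2 := h1.sub_const ε
    refine h2.congr_deriv ?_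
    rw [mul_div_mul_left _ _ two_ne_zero]
  have hg'c : Continuous g' := by
    apply hsc.div (by fun_prop) (fun t => (hsq t).ne')
  have hg'0 : ∀ t, 0 ≤ g' t := fun t => div_nonneg (hs0 t) (hsq t).le
  have hg'1 : ∀ t, g' t ≤ 1 := fun t => by
    show s t / √(ε ^ 2 + s t ^ 2) ≤ 1
    rw [div_le_one (hsq t)]
    exact Real.le_sqrt_of_sq_le (by nlinarith [sq_nonneg ε])
  have hg'2 : ∀ t, 2 * ε ≤ t → 1 / 2 ≤ g' t := fun t ht => by
    have h1 : ε ≤ s t := le_trans (by linarith) (le_max_left _ _)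
    simp only [hg']
    rw [div_le_div_iff₀ two_pos (hsq t), one_mul]
    apply Real.sqrt_le_iff.2
    constructor
    · linarith [hs0 t]
    · nlinarith
  have hcub : ∀ t, (1 + g t) ^ (1 / 3 - 1 : ℝ) * ((1 + g t) ^ (1 / 3 : ℝ)) ^ 2 = 1 := fun t => by
    have h1 : 0 < 1 + g t := by linarith [hg0 t]
    rw [← Real.rpow_natCast, ← Real.rpow_mul h1.le, ← Real.rpow_add h1]
    norm_num
  refine ⟨fun t => (1 + g t) ^ (1 / 3 : ℝ) - 1,
    fun t => g' t * (1 / 3) * (1 + g t) ^ (1 / 3 - 1 : ℝ), ?_, ?_, ?_, ?_, ?_, ?_, ?_⟩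
  · intro t
    have h1 : 0 < 1 + g t := by linarith [hg0 t]
    exact (((hgd t).const_add 1).rpow_const (Or.inl h1.ne')).sub_const 1
  · refine (hg'c.mul continuous_const).mul ?_
    have hgc : Continuous g := by fun_prop
    exact (continuous_const.add hgc).rpow_const (fun t => Or.inl (by
      have := hg0 t
      have h1 : 0 < 1 + g t := by linarith
      exact h1.ne'))
  · intro t ht
    have : s t = 0 := max_eq_right (by linarith)
    simp [hg, this, Real.sqrt_sq hε.le]
  · intro t
    have : (1 : ℝ) ≤ (1 + g t) ^ (1 / 3 : ℝ) := Real.one_le_rpow (by linarith [hg0 t]) (by norm_num)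
    dsimp only; linarith
  · intro t
    have h1 : 0 < 1 + g t := by linarith [hg0 t]
    have := hg'0 t
    dsimp only
    positivity
  · intro t
    have := hcub t
    have h3 := hg'1 t
    calc _ = g' t * (1/3) * ((1 + g t) ^ (1 / 3 - 1 : ℝ) * ((1 + g t) ^ (1 / 3 : ℝ)) ^ 2) := by ring
      _ ≤ 1 := by rw [this]; linarith
  · intro t ht
    have := hcub t
    have h3 := hg'2 t ht
    calc _ ≤ g' t * (1/3) * ((1 + g t) ^ (1 / 3 - 1 : ℝ) * ((1 + g t) ^ (1 / 3 : ℝ)) ^ 2) := by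
            rw [this]; linarith
      _ = _ := by ring


/-- Extension by zero of a `C¹` function vanishing off a compact subset. -/
lemma contDiff_indicator {Ω K : Set E2} (hΩ : IsOpen Ω) (hK : IsCompact K) (hKΩ : K ⊆ Ω)
    {h : E2 → ℝ} (hh : ContDiffOn ℝ 1 h Ω) (h0 : ∀ x ∈ Ω, x ∉ K → h x = 0) :
    ContDiff ℝ 1 (Ω.indicator h) ∧ HasCompactSupport (Ω.indicator h) ∧
    (∀ x ∈ Ω, fderiv ℝ (Ω.indicator h) x = fderiv ℝ h x) ∧
    (∀ x ∉ Ω, fderiv ℝ (Ω.indicator h) x = 0) := by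
  have hz : ∀ x ∉ K, Ω.indicator h x = 0 := by
    intro x hx
    by_cases hxΩ : x ∈ Ω
    · rw [indicator_of_mem hxΩ, h0 x hxΩ hx]
    · exact indicator_of_notMem hxΩ _
  have e1 : ∀ x ∈ Ω, Ω.indicator h =ᶠ[𝓝 x] h := fun x hx => by
    filter_upwards [hΩ.mem_nhds hx] with y hy using indicator_of_mem hy _
  have e2 : ∀ x ∉ Ω, Ω.indicator h =ᶠ[𝓝 x] fun _ => 0 := fun x hx => by
    filter_upwards [hK.isClosed.isOpen_compl.mem_nhds (fun hk => hx (hKΩ hk))] with y hy using hz y hy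
  refine ⟨?_, HasCompactSupport.intro hK hz, ?_, ?_⟩
  · rw [contDiff_iff_contDiffAt]
    intro x
    by_cases hx : x ∈ Ω
    · exact (hh.contDiffAt (hΩ.mem_nhds hx)).congr_of_eventuallyEq (e1 x hx)
    · exact contDiffAt_const.congr_of_eventuallyEq (e2 x hx)
  · intro x hx
    exact (e1 x hx).fderiv_eq
  · intro x hx
    rw [(e2 x hx).fderiv_eq]; simp

lemma integral_fderiv_zero {f : E2 → ℝ} (hf : ContDiff ℝ 1 f) (hc : HasCompactSupport f) (v : E2) :
    ∫ x, fderiv ℝ f x v = 0 := by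
  have h1 : Continuous fun x => fderiv ℝ f x v :=
    (hf.continuous_fderiv one_ne_zero).clm_apply continuous_const
  have h2 : HasCompactSupport fun x => fderiv ℝ f x v := hc.fderiv_apply ℝ v
  have := integral_mul_fderiv_eq_neg_fderiv_mul_of_integrable (μ := (volume : Measure E2))
    (f := fun _ : E2 => (1:ℝ)) (g := f) (v := v) (by simp)
    (by simpa using h1.integrable_of_hasCompactSupport h2)
    (by simpa using hf.continuous.integrable_of_hasCompactSupport hc)
    (fun x _ => differentiableAt_const _) (fun x _ => hf.differentiable one_ne_zero x)
  simpa using this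

lemma norm_sq_fderiv (L : E2 →L[ℝ] ℝ) : ‖L‖ ^ 2 = ∑ i : Fin 2, L (EuclideanSpace.single i 1) ^ 2 := by
  simpa using (EuclideanSpace.basisFun (Fin 2) ℝ).norm_dual L

/-- The compact superlevel set. -/
lemma compact_superlevel {Ω : Set E2} (hΩ : IsOpen Ω) (hΩb : Bornology.IsBounded Ω) {u : E2 → ℝ}
    (hu : ContinuousOn u (closure Ω)) (hu0 : ∀ x ∈ frontier Ω, u x = 0) {ε : ℝ} (hε : 0 < ε) :
    IsCompact (closure Ω ∩ u ⁻¹' Ici ε) ∧ closure Ω ∩ u ⁻¹' Ici ε ⊆ Ω := by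
  have hc : IsCompact (closure Ω) := hΩb.isCompact_closure
  refine ⟨hc.of_isClosed_subset (hu.preimage_isClosed_of_isClosed isClosed_closure isClosed_Ici)
    inter_subset_left, ?_⟩
  rintro x ⟨hx, hxu⟩
  by_contra hn
  have : x ∈ frontier Ω := by rw [hΩ.frontier_eq]; exact ⟨hx, hn⟩
  have := hu0 x this
  simp only [mem_preimage, mem_Ici] at hxu
  linarith

lemma lap_facts {Ω : Set E2} (hΩ : IsOpen Ω) {u : E2 → ℝ} (hu : ContDiffOn ℝ 2 u Ω) :
    ContDiffOn ℝ 1 (fderiv ℝ u) Ω ∧ ContinuousOn (lap u) Ω := by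
  have h1 : ContDiffOn ℝ 1 (fderiv ℝ u) Ω := hu.fderiv_of_isOpen hΩ (by norm_num)
  refine ⟨h1, ?_⟩
  unfold lap
  refine continuousOn_finsetSum _ fun i _ => ?_
  have h2 : ContDiffOn ℝ 1 (fun y => fderiv ℝ u y (EuclideanSpace.single i 1)) Ω :=
    h1.clm_apply contDiffOn_const
  exact (h2.continuousOn_fderiv_of_isOpen hΩ le_rfl).clm_apply continuousOn_const

/-- Testing the equation with `φ(u)`. -/
lemma energy_identity {Ω : Set E2} (hΩ : IsOpen Ω) (hΩb : Bornology.IsBounded Ω) {u : E2 → ℝ}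
    (hu : ContDiffOn ℝ 2 u Ω) (huc : ContinuousOn u (closure Ω))
    (hu0 : ∀ x ∈ frontier Ω, u x = 0) {ε : ℝ} (hε : 0 < ε)
    {φ φ' : ℝ → ℝ} (hφ : ∀ t, HasDerivAt φ (φ' t) t) (hφ' : Continuous φ')
    (hφ0 : ∀ t ≤ ε, φ t = 0) :
    IntegrableOn (fun x => φ' (u x) * ‖fderiv ℝ u x‖ ^ 2) Ω ∧
    IntegrableOn (fun x => φ (u x) * lap u x) Ω ∧
    ∫ x in Ω, φ' (u x) * ‖fderiv ℝ u x‖ ^ 2 = - ∫ x in Ω, φ (u x) * lap u x := by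
  obtain ⟨hK, hKΩ⟩ := compact_superlevel hΩ hΩb huc hu0 hε
  set K := closure Ω ∩ u ⁻¹' Ici ε with hKdef
  obtain ⟨hd1, hlapc⟩ := lap_facts hΩ hu
  have hφ'0 : ∀ t < ε, φ' t = 0 := fun t ht => by
    have : φ =ᶠ[𝓝 t] fun _ => 0 := by
      filter_upwards [Iio_mem_nhds ht] with y hy using hφ0 y (le_of_lt hy)
    have h2 := (hasDerivAt_const t (0:ℝ)).congr_of_eventuallyEq this
    exact (hφ t).unique h2
  have hφC : ContDiff ℝ 1 φ := by
    rw [contDiff_one_iff_deriv]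
    refine ⟨fun t => (hφ t).differentiableAt, ?_⟩
    rw [show deriv φ = φ' from funext fun t => (hφ t).deriv]; exact hφ'
  have hnotK : ∀ x ∈ Ω, x ∉ K → u x < ε := fun x hx hxK => by
    by_contra h
    exact hxK ⟨subset_closure hx, not_lt.1 h⟩
  have hφu : ContDiffOn ℝ 1 (fun x => φ (u x)) Ω :=
    hφC.comp_contDiffOn (hu.of_le (by norm_num))
  have hui : ∀ i : Fin 2, ContDiffOn ℝ 1 (fun y => fderiv ℝ u y (EuclideanSpace.single i 1)) Ω :=
    fun i => hd1.clm_apply contDiffOn_const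
  have hV := fun i : Fin 2 => contDiff_indicator hΩ hK hKΩ
    (h := fun x => φ (u x) * fderiv ℝ u x (EuclideanSpace.single i 1)) (hφu.mul (hui i))
    (fun x hx hxK => by rw [hφ0 _ (hnotK x hx hxK).le, zero_mul])
  -- integrability
  have hint : ∀ h : E2 → ℝ, ContinuousOn h Ω → (∀ x ∈ Ω, x ∉ K → h x = 0) → IntegrableOn h Ω := by
    intro h hc h0
    have h1 : IntegrableOn h K := (hc.mono hKΩ).integrableOn_compact hK
    refine (h1.integrable_indicator hK.measurableSet).integrableOn.congr_fun ?_ hΩ.measurableSet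
    intro x hx
    by_cases hxK : x ∈ K
    · simp [hxK]
    · simp [hxK, h0 x hx hxK]
  have huΩ : ContinuousOn u Ω := huc.mono subset_closure
  have i1 : IntegrableOn (fun x => φ' (u x) * ‖fderiv ℝ u x‖ ^ 2) Ω := by
    apply hint
    · exact (hφ'.comp_continuousOn huΩ).mul (hd1.continuousOn.norm.pow 2)
    · intro x hx hxK
      rw [hφ'0 _ (hnotK x hx hxK), zero_mul]
  have i2 : IntegrableOn (fun x => φ (u x) * lap u x) Ω := by
    apply hint
    · exact (hφu.continuousOn).mul hlapc
    · intro x hx hxK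
      rw [hφ0 _ (hnotK x hx hxK).le, zero_mul]
  refine ⟨i1, i2, ?_⟩
  have key : ∀ x ∈ Ω, φ' (u x) * ‖fderiv ℝ u x‖ ^ 2 + φ (u x) * lap u x =
      ∑ i : Fin 2, fderiv ℝ (Ω.indicator
        (fun x => φ (u x) * fderiv ℝ u x (EuclideanSpace.single i 1))) x
          (EuclideanSpace.single i 1) := by
    intro x hx
    have hux : HasFDerivAt u (fderiv ℝ u x) x :=
      ((hu.contDiffAt (hΩ.mem_nhds hx)).differentiableAt (by norm_num)).hasFDerivAt
    have hφx : HasFDerivAt (fun x => φ (u x)) (φ' (u x) • fderiv ℝ u x) x :=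
      (hφ (u x)).comp_hasFDerivAt x hux
    have : ∀ i : Fin 2, fderiv ℝ (Ω.indicator
        (fun x => φ (u x) * fderiv ℝ u x (EuclideanSpace.single i 1))) x
          (EuclideanSpace.single i 1) = φ (u x) *
          fderiv ℝ (fun y => fderiv ℝ u y (EuclideanSpace.single i 1)) x (EuclideanSpace.single i 1)
          + φ' (u x) * fderiv ℝ u x (EuclideanSpace.single i 1) ^ 2 := by
      intro i
      rw [(hV i).2.2.1 x hx]
      have hdi := (((hui i).contDiffAt (hΩ.mem_nhds hx)).differentiableAt one_ne_zero).hasFDerivAt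
      rw [(hφx.fun_mul hdi).fderiv]
      simp
      ring
    rw [norm_sq_fderiv]
    simp only [this, lap, Finset.sum_add_distrib, Finset.mul_sum]
    ring
  have h3 : ∫ x in Ω, (φ' (u x) * ‖fderiv ℝ u x‖ ^ 2 + φ (u x) * lap u x) = 0 := by
    rw [setIntegral_congr_fun hΩ.measurableSet key, setIntegral_eq_integral_of_forall_compl_eq_zero]
    · rw [integral_finsetSum]
      · exact Finset.sum_eq_zero fun i _ => integral_fderiv_zero (hV i).1 (hV i).2.1 _
      · intro i _
        exact (((hV i).1.continuous_fderiv one_ne_zero).clm_apply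
          continuous_const).integrable_of_hasCompactSupport ((hV i).2.1.fderiv_apply ℝ _)
    · intro x hx
      exact Finset.sum_eq_zero fun i _ => by rw [(hV i).2.2.2 x hx]; rfl
  rw [integral_add i1 i2] at h3
  linarith

/-- The Laplacian is bounded on `Ω`. -/
lemma lap_bounded {Ω : Set E2} (hΩ : IsOpen Ω) (hΩb : Bornology.IsBounded Ω) {u : E2 → ℝ}
    (hu : ContDiffOn ℝ 2 u (closure Ω)) : ∃ M, ∀ x ∈ Ω, |lap u x| ≤ M := by
  have hc : IsCompact (closure Ω) := hΩb.isCompact_closure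
  suffices h : ∃ M, ∀ x ∈ closure Ω, x ∈ Ω → |lap u x| ≤ M by
    obtain ⟨M, hM⟩ := h
    exact ⟨M, fun x hx => hM x (subset_closure hx) hx⟩
  refine hc.induction_on (p := fun s => ∃ M, ∀ x ∈ s, x ∈ Ω → |lap u x| ≤ M) ⟨0, by simp⟩ ?_ ?_ ?_
  · rintro s t hst ⟨M, hM⟩
    exact ⟨M, fun x hx => hM x (hst hx)⟩
  · rintro s t ⟨M, hM⟩ ⟨N, hN⟩
    refine ⟨max M N, fun x hx hxΩ => ?_⟩
    rcases hx with hx | hx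
    · exact (hM x hx hxΩ).trans (le_max_left _ _)
    · exact (hN x hx hxΩ).trans (le_max_right _ _)
  · intro x hx
    have h2 : ContDiffWithinAt ℝ (1 + 1) u (closure Ω) x := by
      have := hu x hx
      norm_num at this ⊢; exact this
    obtain ⟨v, hv, hvs, -, f', hf', hf'c⟩ :=
      (contDiffWithinAt_succ_iff_hasFDerivWithinAt' (by simp)).1 h2
    have h3 : ContDiffWithinAt ℝ (0 + 1) f' (closure Ω) x := by simpa using hf'c
    obtain ⟨w, hw, hws, -, f'', hf'', hf''c⟩ :=
      (contDiffWithinAt_succ_iff_hasFDerivWithinAt' (by simp)).1 h3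
    rw [insert_eq_of_mem hx] at hv hw
    have hb : ∀ᶠ y in 𝓝[closure Ω] x, ‖f'' y‖ < ‖f'' x‖ + 1 := by
      exact (hf''c.continuousWithinAt.norm).eventually (gt_mem_nhds (by linarith))
    have hvw : ∀ᶠ y in 𝓝[closure Ω] x, y ∈ v ∧ y ∈ w := by
      filter_upwards [hv, hw] with y h1 h2 using ⟨h1, h2⟩
    rw [eventually_nhdsWithin_iff] at hvw
    obtain ⟨O, hO, hOo, hxO⟩ := _root_.eventually_nhds_iff.1 hvw
    refine ⟨{y | ‖f'' y‖ < ‖f'' x‖ + 1} ∩ O,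
      inter_mem hb (mem_nhdsWithin_of_mem_nhds (hOo.mem_nhds hxO)), 2 * (‖f'' x‖ + 1), ?_⟩
    rintro y ⟨hy1, hyO⟩ hyΩ
    have hder : ∀ z ∈ Ω ∩ O, HasFDerivAt u (f' z) z ∧ HasFDerivAt f' (f'' z) z := by
      rintro z ⟨hz, hzO⟩
      have hn : closure Ω ∈ 𝓝 z := mem_of_superset (hΩ.mem_nhds hz) subset_closure
      obtain ⟨h1, h2⟩ := hO z hzO (subset_closure hz)
      exact ⟨(hf' z h1).hasFDerivAt hn, (hf'' z h2).hasFDerivAt hn⟩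
    have hlap : lap u y = ∑ i : Fin 2, f'' y (EuclideanSpace.single i 1) (EuclideanSpace.single i 1) := by
      unfold lap
      refine Finset.sum_congr rfl fun i _ => ?_
      have : (fun y => fderiv ℝ u y (EuclideanSpace.single i (1:ℝ))) =ᶠ[𝓝 y]
          fun y => f' y (EuclideanSpace.single i 1) := by
        filter_upwards [(hΩ.inter hOo).mem_nhds ⟨hyΩ, hyO⟩] with z hz
        rw [(hder z hz).1.fderiv]
      rw [this.fderiv_eq]
      have h4 := (hder y ⟨hyΩ, hyO⟩).2.clm_apply
        (hasFDerivAt_const (EuclideanSpace.single i (1:ℝ)) y)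
      rw [h4.fderiv]
      simp
    rw [hlap]
    refine (Finset.abs_sum_le_sum_abs _ _).trans ?_
    have : ∀ i : Fin 2, |f'' y (EuclideanSpace.single i 1) (EuclideanSpace.single i 1)| ≤ ‖f'' x‖ + 1 := by
      intro i
      have := (f'' y).le_opNorm₂ (EuclideanSpace.single i 1) (EuclideanSpace.single i 1)
      simp only [PiLp.norm_single, norm_one, mul_one, Real.norm_eq_abs] at this
      exact this.trans hy1.le
    calc _ ≤ ∑ i : Fin 2, (‖f'' x‖ + 1) := Finset.sum_le_sum fun i _ => this i
      _ = _ := by simp; ring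

/-- The gradient vanishes a.e. on the zero set. -/
lemma fderiv_zero_ae {Ω : Set E2} (hΩ : IsOpen Ω) {u : E2 → ℝ} (hu : ContDiffOn ℝ 2 u Ω) :
    MeasurableSet (Ω ∩ u ⁻¹' {0}) ∧
    ∀ᵐ x ∂(volume.restrict (Ω ∩ u ⁻¹' {0})), fderiv ℝ u x = 0 := by
  have hm : MeasurableSet (Ω ∩ u ⁻¹' {0}) := by
    have := hu.continuousOn.isOpen_inter_preimage hΩ (isOpen_compl_singleton (x := (0:ℝ)))
    have h2 : Ω ∩ u ⁻¹' {0} = Ω \ (Ω ∩ u ⁻¹' {0}ᶜ) := by ext x; simp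
    rw [h2]; exact hΩ.measurableSet.diff this.measurableSet
  refine ⟨hm, ?_⟩
  set e : E2 := EuclideanSpace.single 0 1
  have happ : ApproximatesLinearOn (fun x => u x • e) (0 : E2 →L[ℝ] E2) (Ω ∩ u ⁻¹' {0}) 0 := by
    rintro x ⟨_, hx⟩ y ⟨_, hy⟩
    simp only [mem_preimage, mem_singleton_iff] at hx hy
    simp [hx, hy]
  have := happ.norm_fderiv_sub_le volume hm (fun x => (fderiv ℝ u x).smulRight e) (by
    rintro x ⟨hx, _⟩
    have hux : HasFDerivAt u (fderiv ℝ u x) x :=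
      ((hu.contDiffAt (hΩ.mem_nhds hx)).differentiableAt (by norm_num)).hasFDerivAt
    exact (hux.smul_const e).hasFDerivWithinAt)
  filter_upwards [this] with x hx
  simp only [sub_zero, nonpos_iff_eq_zero, nnnorm_eq_zero] at hx
  ext v
  have h2 := congrArg (fun L : E2 →L[ℝ] E2 => L v) hx
  simp only [ContinuousLinearMap.smulRight_apply, zero_apply, smul_eq_zero] at h2
  rcases h2 with h2 | h2
  · simpa using h2
  · simp [e] at h2


lemma eLpNorm_restrict_aux {F : Type*} [NormedAddCommGroup F] (f : E2 → F) (p : ℝ≥0∞) {Ω : Set E2}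
    (h : ∀ x ∉ Ω, f x = 0) : eLpNorm f p volume = eLpNorm f p (volume.restrict Ω) := by
  have hs : f.support ⊆ Ω := fun x hx => by by_contra hn; exact hx (h x hn)
  exact (eLpNorm_restrict_eq_of_support_subset hs).symm

/-- Sobolev inequality `W₀^{1,2} ⊂ L^r` on a bounded planar set. -/
lemma sobolev_bound {Ω : Set E2} (hΩb : Bornology.IsBounded Ω)
    {r : ℝ} (hr : 2 ≤ r) : ∃ C : ℝ≥0, ∀ w : E2 → ℝ, ContDiff ℝ 1 w → (∀ x ∉ Ω, w x = 0) →
      (∀ x ∉ Ω, fderiv ℝ w x = 0) →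
      eLpNorm w (ENNReal.ofReal r) volume ≤ C * eLpNorm (fderiv ℝ w) 2 (volume.restrict Ω) := by
  have hr0 : 0 < r := by linarith
  set p : ℝ≥0 := ⟨2 * r / (r + 2), by positivity⟩ with hp
  have hpv : (p : ℝ) = 2 * r / (r + 2) := rfl
  set r' : ℝ≥0 := r.toNNReal with hr'
  have hrv : (r' : ℝ) = r := Real.coe_toNNReal _ hr0.le
  have hfin : (Module.finrank ℝ E2 : ℝ) = 2 := by simp
  have hfin' : Module.finrank ℝ E2 = 2 := by simp
  have hp1 : 1 ≤ p := by
    rw [← NNReal.coe_le_coe, hpv, NNReal.coe_one, le_div_iff₀ (by positivity)]; linarith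
  have hp2 : p < 2 := by
    rw [← NNReal.coe_lt_coe, hpv, div_lt_iff₀ (by positivity)]
    push_cast; linarith
  have hvol : volume Ω < ∞ := hΩb.measure_lt_top
  refine ⟨eLpNormLESNormFDerivOfLeConst ℝ volume Ω p r' *
    ((volume Ω) ^ (1 / (p:ℝ) - 1 / 2)).toNNReal, fun w hw hw0 hfw0 => ?_⟩
  have h1 := eLpNorm_le_eLpNorm_fderiv_of_le (volume : Measure E2) (F := ℝ) (u := w) (s := Ω) hw
    (fun x hx => by by_contra h; exact hx (hw0 x h)) (p := p) (q := r') hp1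
    (by rw [hfin']; exact_mod_cast hp2)
    (by rw [hfin, NNReal.coe_inv, hpv, hrv]
        apply le_of_eq; field_simp; ring) hΩb
  have h2 : eLpNorm (fderiv ℝ w) p volume = eLpNorm (fderiv ℝ w) p (volume.restrict Ω) := by
    exact eLpNorm_restrict_aux _ _ hfw0
  have h3 := eLpNorm_le_eLpNorm_mul_rpow_measure_univ (μ := volume.restrict Ω) (p := p) (q := 2)
    (f := fderiv ℝ w) (by exact_mod_cast hp2.le)
    (hw.continuous_fderiv one_ne_zero).aestronglyMeasurable
  have hexp : (0:ℝ) ≤ 1 / (p:ℝ) - 1 / 2 := by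
    rw [hpv]; rw [one_div_div]; rw [sub_nonneg, div_le_div_iff₀ (by norm_num) (by positivity)]; linarith
  have hne : (volume Ω) ^ (1 / (p:ℝ) - 1 / 2) ≠ ∞ := ENNReal.rpow_ne_top_of_nonneg hexp hvol.ne
  rw [Measure.restrict_apply_univ] at h3
  simp only [ENNReal.coe_toReal, ENNReal.toReal_ofNat] at h3
  have hof : ENNReal.ofReal r = (r' : ℝ≥0∞) := rfl
  rw [hof]
  refine h1.trans ?_
  rw [h2, ENNReal.coe_mul, ENNReal.coe_toNNReal hne, mul_assoc]
  gcongr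
  rw [mul_comm]; exact h3

/-- The pointwise Young inequality. -/
lemma young_pt {q : ℝ} (hq1 : 1 < q) (hq2 : q < 2) {a b : ℝ} (ha : 0 ≤ a) (hb : 1 ≤ b) :
    a ^ q ≤ a ^ 2 / b ^ 4 + b ^ (4 * q / (2 - q)) := by
  have hb0 : 0 < b := by linarith
  have hq : 0 < 2 - q := by linarith
  have h := Real.geom_mean_le_arith_mean2_weighted (w₁ := q / 2) (w₂ := 1 - q / 2)
    (p₁ := a ^ 2 / b ^ 4) (p₂ := b ^ (4 * q / (2 - q))) (by linarith) (by linarith)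
    (by positivity) (by positivity) (by ring)
  have e1 : (a ^ 2 / b ^ 4) ^ (q / 2) = a ^ q / b ^ (2 * q) := by
    rw [Real.div_rpow (by positivity) (by positivity), ← Real.rpow_natCast, ← Real.rpow_natCast,
      ← Real.rpow_mul ha, ← Real.rpow_mul hb0.le]
    congr 2 <;> push_cast <;> ring
  have e2 : (b ^ (4 * q / (2 - q))) ^ (1 - q / 2) = b ^ (2 * q) := by
    rw [← Real.rpow_mul hb0.le]; congr 1; field_simp; ring
  rw [e1, e2, div_mul_cancel₀ _ (by positivity)] at h
  have h1 : 0 ≤ a ^ 2 / b ^ 4 := by positivity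
  have h2 : 0 ≤ b ^ (4 * q / (2 - q)) := by positivity
  nlinarith

lemma pos_bound {Ω : Set E2} (hΩ : IsOpen Ω) (hΩb : Bornology.IsBounded Ω)
    (C₀ : ℝ) {q : ℝ} (hq1 : 1 < q) (hq2 : q < 2) :
    ∃ C : ℝ≥0, ∀ u : E2 → ℝ, ContDiffOn ℝ 2 u (closure Ω) → (∀ x ∈ frontier Ω, u x = 0) →
      (∫ x in Ω, |lap u x|) ≤ C₀ → ∀ ε > 0,
      ∫⁻ x in Ω ∩ u ⁻¹' Ici (2 * ε), ENNReal.ofReal (‖fderiv ℝ u x‖ ^ q) ≤ C := by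
  set r : ℝ := 4 * q / (2 - q) with hr
  have hr2 : 2 ≤ r := by
    rw [hr, le_div_iff₀ (by linarith)]; linarith
  have hr0 : 0 < r := by linarith
  obtain ⟨C, hC⟩ := sobolev_bound hΩb hr2
  have hvol : volume Ω < ∞ := hΩb.measure_lt_top
  set A : ℝ≥0∞ := (C * ENNReal.ofReal C₀ ^ (1 / 2 : ℝ)) ^ r with hA
  have hAt : A ≠ ∞ := ENNReal.rpow_ne_top_of_nonneg hr0.le (ENNReal.mul_ne_top (by simp)
    (ENNReal.rpow_ne_top_of_nonneg (by norm_num) (by simp)))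
  set T : ℝ≥0∞ := 8 * ENNReal.ofReal C₀ + 2 ^ (r - 1) * (volume Ω + A) with hT
  have hTt : T ≠ ∞ := by
    refine ENNReal.add_ne_top.2 ⟨ENNReal.mul_ne_top (by simp) (by simp), ENNReal.mul_ne_top ?_ ?_⟩
    · exact ENNReal.rpow_ne_top_of_nonneg (by linarith) (by simp)
    · exact ENNReal.add_ne_top.2 ⟨hvol.ne, hAt⟩
  refine ⟨T.toNNReal, fun u hu hu0 hlap ε hε => ?_⟩
  rw [ENNReal.coe_toNNReal hTt]
  obtain ⟨k, k', hk, hk'c, hk0, hkn, hk'n, hkle, hkge⟩ := exists_trunc ε hε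
  have huΩ : ContDiffOn ℝ 2 u Ω := hu.mono subset_closure
  have h1k : ∀ t, 0 < 1 + k t := fun t => by linarith [hkn t]
  have hkc : Continuous k := continuous_iff_continuousAt.2 fun t => (hk t).continuousAt
  -- energy
  obtain ⟨i1, i2, hen⟩ := energy_identity hΩ hΩb huΩ hu.continuousOn hu0 hε
    (φ := fun t => 1 - (1 + k t)⁻¹) (φ' := fun t => k' t / (1 + k t) ^ 2)
    (fun t => by
      have := (((hk t).const_add 1).fun_inv (h1k t).ne').const_sub 1
      refine this.congr_deriv ?_
      ring)
    (hk'c.div (by fun_prop) fun t => (pow_pos (h1k t) 2).ne')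
    (fun t ht => by simp [hk0 t ht])
  obtain ⟨M, hM⟩ := lap_bounded hΩ hΩb hu
  have hlapi : IntegrableOn (fun x => |lap u x|) Ω := by
    refine IntegrableOn.of_bound hvol ?_ M ?_
    · exact ((lap_facts hΩ huΩ).2.abs).aestronglyMeasurable hΩ.measurableSet
    · filter_upwards [ae_restrict_mem hΩ.measurableSet] with x hx
      simpa using hM x hx
  have henergy : ∫ x in Ω, k' (u x) / (1 + k (u x)) ^ 2 * ‖fderiv ℝ u x‖ ^ 2 ≤ C₀ := by
    rw [hen, ← integral_neg]
    refine le_trans (integral_mono i2.neg hlapi fun x => ?_) hlap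
    have h2 : (1 + k (u x))⁻¹ ≤ 1 := inv_le_one_of_one_le₀ (by linarith [hkn (u x)])
    have h3 : 0 < (1 + k (u x))⁻¹ := inv_pos.2 (h1k _)
    show -((1 - (1 + k (u x))⁻¹) * lap u x) ≤ |lap u x|
    refine (neg_le_abs _).trans ?_
    rw [abs_mul]
    apply mul_le_of_le_one_left (abs_nonneg _)
    rw [abs_le]; constructor <;> linarith
  have hφnn : ∀ x, 0 ≤ k' (u x) / (1 + k (u x)) ^ 2 * ‖fderiv ℝ u x‖ ^ 2 := fun x => by
    have := hk'n (u x); have := h1k (u x); positivity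
  set F : E2 → ℝ≥0∞ := fun x =>
    ENNReal.ofReal (k' (u x) / (1 + k (u x)) ^ 2 * ‖fderiv ℝ u x‖ ^ 2) with hF
  have hFi : ∫⁻ x in Ω, F x ≤ ENNReal.ofReal C₀ := by
    rw [← ofReal_integral_eq_lintegral_ofReal i1 (Eventually.of_forall hφnn)]
    exact ENNReal.ofReal_le_ofReal henergy
  have hFm : AEMeasurable F (volume.restrict Ω) := i1.1.aemeasurable.ennreal_ofReal
  -- the extended function
  obtain ⟨hK, hKΩ⟩ := compact_superlevel hΩ hΩb hu.continuousOn hu0 hε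
  have hkC : ContDiff ℝ 1 k := by
    rw [contDiff_one_iff_deriv]
    refine ⟨fun t => (hk t).differentiableAt, ?_⟩
    rw [show deriv k = k' from funext fun t => (hk t).deriv]; exact hk'c
  obtain ⟨w1, -, w3, w4⟩ := contDiff_indicator hΩ hK hKΩ (h := fun x => k (u x))
    (hkC.comp_contDiffOn (huΩ.of_le (by norm_num)))
    (fun x hx hxK => hk0 _ (by
      by_contra h
      exact hxK ⟨subset_closure hx, (not_le.1 h).le⟩))
  set w : E2 → ℝ := Ω.indicator (fun x => k (u x)) with hw
  have hwS := hC w w1 (fun x hx => indicator_of_notMem hx _) w4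
  have hgrad : ∀ x ∈ Ω, ‖fderiv ℝ w x‖ₑ ^ (2:ℝ) ≤ F x := by
    intro x hx
    have hux : HasFDerivAt u (fderiv ℝ u x) x :=
      ((huΩ.contDiffAt (hΩ.mem_nhds hx)).differentiableAt (by norm_num)).hasFDerivAt
    have hkx : HasFDerivAt (fun x => k (u x)) (k' (u x) • fderiv ℝ u x) x :=
      (hk (u x)).comp_hasFDerivAt x hux
    rw [w3 x hx, hkx.fderiv, ← ofReal_norm, ENNReal.ofReal_rpow_of_nonneg (norm_nonneg _)
      (by norm_num)]
    apply ENNReal.ofReal_le_ofReal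
    rw [norm_smul, Real.norm_eq_abs, abs_of_nonneg (hk'n _)]
    norm_cast
    rw [mul_pow]
    gcongr
    rw [le_div_iff₀ (pow_pos (h1k _) 2)]
    nlinarith [hkle (u x), hk'n (u x)]
  have hL2 : eLpNorm (fderiv ℝ w) 2 (volume.restrict Ω) ≤ ENNReal.ofReal C₀ ^ (1 / 2 : ℝ) := by
    rw [eLpNorm_eq_lintegral_rpow_enorm_toReal (by norm_num) (by norm_num)]
    simp only [ENNReal.toReal_ofNat]
    gcongr
    exact (setLIntegral_mono' hΩ.measurableSet hgrad).trans hFi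
  have hLr : ∫⁻ x, ‖w x‖ₑ ^ r ≤ A := by
    have h1 : eLpNorm w (ENNReal.ofReal r) volume ≤ C * ENNReal.ofReal C₀ ^ (1 / 2 : ℝ) :=
      hwS.trans (by gcongr)
    rw [eLpNorm_eq_lintegral_rpow_enorm_toReal (by simpa using hr0) (by simp),
      ENNReal.toReal_ofReal hr0.le] at h1
    have h2 := ENNReal.rpow_le_rpow h1 hr0.le
    rwa [← ENNReal.rpow_mul, one_div_mul_cancel hr0.ne', ENNReal.rpow_one] at h2
  -- pointwise estimate
  have hpt : ∀ x ∈ Ω ∩ u ⁻¹' Ici (2 * ε), ENNReal.ofReal (‖fderiv ℝ u x‖ ^ q) ≤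
      8 * F x + 2 ^ (r - 1) * (1 + ‖w x‖ₑ ^ r) := by
    rintro x ⟨hx, hxu⟩
    have hwx : w x = k (u x) := indicator_of_mem hx _
    have hy := young_pt hq1 hq2 (norm_nonneg (fderiv ℝ u x)) (b := 1 + k (u x))
      (by linarith [hkn (u x)])
    have hge := hkge (u x) hxu
    have h8 : ‖fderiv ℝ u x‖ ^ 2 / (1 + k (u x)) ^ 4 ≤
        8 * (k' (u x) / (1 + k (u x)) ^ 2 * ‖fderiv ℝ u x‖ ^ 2) := by
      have e : 8 * (k' (u x) / (1 + k (u x)) ^ 2 * ‖fderiv ℝ u x‖ ^ 2) =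
        (8 * (k' (u x) * (1 + k (u x)) ^ 2)) * (‖fderiv ℝ u x‖ ^ 2 / (1 + k (u x)) ^ 4) := by
        have := (h1k (u x)).ne'
        field_simp
      rw [e]
      apply le_mul_of_one_le_left
      · have := h1k (u x); positivity
      · linarith
    have h9 : ENNReal.ofReal ((1 + k (u x)) ^ r) ≤ 2 ^ (r - 1) * (1 + ‖w x‖ₑ ^ r) := by
      rw [← ENNReal.ofReal_rpow_of_nonneg (h1k _).le hr0.le, ENNReal.ofReal_add zero_le_one (hkn _),
        ENNReal.ofReal_one, hwx, Real.enorm_eq_ofReal (hkn _)]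
      have := ENNReal.rpow_add_le_mul_rpow_add_rpow 1 (ENNReal.ofReal (k (u x))) (p := r)
        (by linarith)
      rwa [ENNReal.one_rpow] at this
    calc ENNReal.ofReal (‖fderiv ℝ u x‖ ^ q)
        ≤ ENNReal.ofReal (8 * (k' (u x) / (1 + k (u x)) ^ 2 * ‖fderiv ℝ u x‖ ^ 2)
            + (1 + k (u x)) ^ r) := ENNReal.ofReal_le_ofReal (by linarith)
      _ ≤ ENNReal.ofReal (8 * (k' (u x) / (1 + k (u x)) ^ 2 * ‖fderiv ℝ u x‖ ^ 2))
            + ENNReal.ofReal ((1 + k (u x)) ^ r) := ENNReal.ofReal_add_le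
      _ ≤ _ := by
        gcongr
        rw [ENNReal.ofReal_mul (by norm_num)]; simp [hF]
  have hms : MeasurableSet (Ω ∩ u ⁻¹' Ici (2 * ε)) := by
    have := huΩ.continuousOn.isOpen_inter_preimage hΩ (isOpen_Iio (a := 2 * ε))
    have h2 : Ω ∩ u ⁻¹' Ici (2 * ε) = Ω \ (Ω ∩ u ⁻¹' Iio (2 * ε)) := by
      ext x
      simp only [mem_inter_iff, mem_preimage, mem_Ici, Set.mem_sdiff, mem_Iio, not_and, not_lt]
      tauto
    rw [h2]; exact hΩ.measurableSet.diff this.measurableSet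
  calc ∫⁻ x in Ω ∩ u ⁻¹' Ici (2 * ε), ENNReal.ofReal (‖fderiv ℝ u x‖ ^ q)
      ≤ ∫⁻ x in Ω ∩ u ⁻¹' Ici (2 * ε), (8 * F x + 2 ^ (r - 1) * (1 + ‖w x‖ₑ ^ r)) :=
        setLIntegral_mono' hms hpt
    _ ≤ ∫⁻ x in Ω, (8 * F x + 2 ^ (r - 1) * (1 + ‖w x‖ₑ ^ r)) :=
        lintegral_mono_set inter_subset_left
    _ = 8 * (∫⁻ x in Ω, F x) + 2 ^ (r - 1) * (volume Ω + ∫⁻ x in Ω, ‖w x‖ₑ ^ r) := by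
        rw [lintegral_add_left' (hFm.const_mul _), lintegral_const_mul' _ _ (by simp),
          lintegral_const_mul' _ _ (ENNReal.rpow_ne_top_of_nonneg (by linarith) (by simp)),
          lintegral_add_left measurable_const]
        simp
    _ ≤ T := by
        rw [hT]
        gcongr
        exact (setLIntegral_le_lintegral _ _).trans hLr

lemma pos_bound' {Ω : Set E2} (hΩ : IsOpen Ω) (hΩb : Bornology.IsBounded Ω)
    (C₀ : ℝ) {q : ℝ} (hq1 : 1 < q) (hq2 : q < 2) :
    ∃ C : ℝ≥0, ∀ u : E2 → ℝ, ContDiffOn ℝ 2 u (closure Ω) → (∀ x ∈ frontier Ω, u x = 0) →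
      (∫ x in Ω, |lap u x|) ≤ C₀ →
      ∫⁻ x in Ω ∩ u ⁻¹' Ioi 0, ENNReal.ofReal (‖fderiv ℝ u x‖ ^ q) ≤ C := by
  obtain ⟨C, hC⟩ := pos_bound hΩ hΩb C₀ hq1 hq2
  refine ⟨C, fun u hu hu0 hlap => ?_⟩
  have hset : Ω ∩ u ⁻¹' Ioi 0 = ⋃ n : ℕ, Ω ∩ u ⁻¹' Ici (2 * (1 / ((n:ℝ) + 1))) := by
    ext x
    simp only [mem_inter_iff, mem_preimage, mem_Ioi, mem_iUnion, mem_Ici]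
    constructor
    · rintro ⟨hx, hpos⟩
      obtain ⟨n, hn⟩ := exists_nat_one_div_lt (half_pos hpos)
      exact ⟨n, hx, by linarith⟩
    · rintro ⟨n, hx, h⟩
      exact ⟨hx, lt_of_lt_of_le (by positivity) h⟩
  have hmono : Monotone fun n : ℕ => Ω ∩ u ⁻¹' Ici (2 * (1 / ((n:ℝ) + 1))) := by
    intro n m hnm
    refine inter_subset_inter_right _ (preimage_mono (Ici_subset_Ici.2 ?_))
    gcongr
  rw [hset, setLIntegral_iUnion_of_directed _ hmono.directed_le]
  exact iSup_le fun n => hC u hu hu0 hlap _ (by positivity)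

lemma lap_neg (u : E2 → ℝ) (x : E2) : lap (fun y => - u y) x = - lap u x := by
  unfold lap
  rw [← Finset.sum_neg_distrib]
  refine Finset.sum_congr rfl fun i _ => ?_
  simp only [fderiv_fun_neg, neg_apply]


/-- **Uniform `L^q` gradient bound, `1 < q < 2`.** If `u ∈ C²(Ω̄)` vanishes on `∂Ω` and
`‖Δu‖_{L¹(Ω)} ≤ C₀`, then `‖∇u‖_{L^q(Ω)} ≤ C_q(C₀, q, Ω)`. -/
theorem gradient_Lq_bound (Ω : Set E2) (hΩo : IsOpen Ω) (hΩb : Bornology.IsBounded Ω)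
    (hΩs : SmoothBoundary Ω) (C₀ : ℝ) (hC₀ : 0 < C₀) (q : ℝ) (hq1 : 1 < q) (hq2 : q < 2) :
    ∃ Cq : ℝ, ∀ u : E2 → ℝ,
      ContDiffOn ℝ 2 u (closure Ω) →
      (∀ x ∈ frontier Ω, u x = 0) →
      (∫ x in Ω, |lap u x|) ≤ C₀ →
      (∫ x in Ω, ‖fderiv ℝ u x‖ ^ q) ^ (1 / q) ≤ Cq := by
  obtain ⟨C, hC⟩ := pos_bound' hΩo hΩb C₀ hq1 hq2
  refine ⟨((C:ℝ) + C) ^ (1 / q), fun u hu hu0 hlap => ?_⟩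
  have huΩ : ContDiffOn ℝ 2 u Ω := hu.mono subset_closure
  have h1 := hC u hu hu0 hlap
  have h2 := hC (fun x => - u x) hu.neg (fun x hx => by simp [hu0 x hx])
    (by simpa only [lap_neg, abs_neg] using hlap)
  simp only [fderiv_fun_neg, norm_neg] at h2
  obtain ⟨hZm, hZ⟩ := fderiv_zero_ae hΩo huΩ
  have h3 : ∫⁻ x in Ω ∩ u ⁻¹' {0}, ENNReal.ofReal (‖fderiv ℝ u x‖ ^ q) = 0 := by
    rw [lintegral_congr_ae (g := fun _ => 0), lintegral_zero]
    filter_upwards [hZ] with x hx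
    rw [hx, norm_zero, Real.zero_rpow (by linarith), ENNReal.ofReal_zero]
  have hsub : Ω ⊆ (Ω ∩ u ⁻¹' Ioi 0 ∪ Ω ∩ (fun x => - u x) ⁻¹' Ioi 0) ∪ Ω ∩ u ⁻¹' {0} := by
    intro x hx
    rcases lt_trichotomy (u x) 0 with h | h | h
    · exact Or.inl (Or.inr ⟨hx, by simpa using h⟩)
    · exact Or.inr ⟨hx, h⟩
    · exact Or.inl (Or.inl ⟨hx, h⟩)
  have h4 : ∫⁻ x in Ω, ENNReal.ofReal (‖fderiv ℝ u x‖ ^ q) ≤ ((C + C : ℝ≥0) : ℝ≥0∞) := by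
    refine (lintegral_mono_set hsub).trans ((lintegral_union_le _ _ _).trans ?_)
    rw [h3, add_zero, ENNReal.coe_add]
    exact (lintegral_union_le _ _ _).trans (add_le_add h1 h2)
  have h5 : ∫ x in Ω, ‖fderiv ℝ u x‖ ^ q ≤ (C:ℝ) + C := by
    rw [integral_eq_lintegral_of_nonneg_ae (Eventually.of_forall fun x => by positivity)]
    · exact ENNReal.toReal_mono ENNReal.coe_ne_top h4
    · refine ContinuousOn.aestronglyMeasurable ?_ hΩo.measurableSet
      exact ((lap_facts hΩo huΩ).1.continuousOn.norm).rpow_const fun x _ => Or.inr (by linarith)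
  exact Real.rpow_le_rpow (integral_nonneg fun x => by positivity) h5 (by positivity)
end
end
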